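/- arXiv:1408.1231 — 2 statements merged into one kernel-verified Lean document; each statement's English description precedes it below -/
import Mathlib

section
/- Let E be a countable MV-algebra. Then there exists a Foulis monoid S satisfying the lattice condition such that S/J (equivalently E(S)/D), equipped with the partial operation ⊕ and complementation [e]' = [ē], is isomorphic to E as an MV-algebra. In other words, every countable MV-algebra can be co-ordinatized by a Foulis monoid satisfying the lattice condition. -/
namespace Coordinatization

/-- The data of a monoid with zero equipped with an inverse operation. -/
structure InvMonData (S : Type) where
  mul : S → S → S
  one : S
  zero : S
  inv : S → S

variable {S T : Type}

/-- `M` is an inverse monoid with zero: a monoid with zero in which every element `a`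
has a unique generalized inverse `a⁻¹`. -/
structure IsInverseMonoid (M : InvMonData S) : Prop where
  mul_assoc : ∀ a b c, M.mul (M.mul a b) c = M.mul a (M.mul b c)
  one_mul : ∀ a, M.mul M.one a = a
  mul_one : ∀ a, M.mul a M.one = a
  zero_mul : ∀ a, M.mul M.zero a = M.zero
  mul_zero : ∀ a, M.mul a M.zero = M.zero
  inv_law₁ : ∀ a, M.mul (M.mul a (M.inv a)) a = a
  inv_law₂ : ∀ a, M.mul (M.mul (M.inv a) a) (M.inv a) = M.inv a
  inv_unique : ∀ a b, M.mul (M.mul a b) a = a → M.mul (M.mul b a) b = b → b = M.inv a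

/-- `e` is an idempotent. -/
def IsIdem (M : InvMonData S) (e : S) : Prop := M.mul e e = e

/-- The natural partial order: `a ≤ b` iff `a = b·e` for some idempotent `e`. -/
def nle (M : InvMonData S) (a b : S) : Prop := ∃ e, IsIdem M e ∧ a = M.mul b e

/-- `a` and `b` are compatible: `a⁻¹b` and `ab⁻¹` are both idempotents. -/
def Compatible (M : InvMonData S) (a b : S) : Prop :=
  IsIdem M (M.mul (M.inv a) b) ∧ IsIdem M (M.mul a (M.inv b))

/-- `a` and `b` are orthogonal: `a⁻¹b = 0 = ab⁻¹`. -/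
def Orthogonal (M : InvMonData S) (a b : S) : Prop :=
  M.mul (M.inv a) b = M.zero ∧ M.mul a (M.inv b) = M.zero

/-- `j` is the join of `a` and `b` with respect to the natural partial order. -/
def IsJoin (M : InvMonData S) (a b j : S) : Prop :=
  nle M a j ∧ nle M b j ∧ ∀ c, nle M a c → nle M b c → nle M j c

/-- `m` is the meet of `a` and `b` with respect to the natural partial order. -/
def IsMeet (M : InvMonData S) (a b m : S) : Prop :=
  nle M m a ∧ nle M m b ∧ ∀ c, nle M c a → nle M c b → nle M c m

/-- Green's relation `D`: `e D f` iff there is `a` with `a⁻¹a = e` and `aa⁻¹ = f`. -/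
def DRel (M : InvMonData S) (e f : S) : Prop :=
  ∃ a, M.mul (M.inv a) a = e ∧ M.mul a (M.inv a) = f

/-- `f` is a Boolean complement of the idempotent `e` in the Boolean algebra of
idempotents: `e·f = 0` and `e ∨ f = 1`. -/
def IsComplPair (M : InvMonData S) (e f : S) : Prop :=
  IsIdem M e ∧ IsIdem M f ∧ M.mul e f = M.zero ∧ IsJoin M e f M.one

/-- A Boolean inverse monoid: an inverse monoid with zero in which the idempotents form a
Boolean algebra under the natural partial order (meets of idempotents are given by products;
complements exist), all compatible binary joins exist, and multiplication distributes over
binary joins. -/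
structure IsBooleanInverseMonoid (M : InvMonData S) : Prop where
  invMon : IsInverseMonoid M
  joins_exist : ∀ a b, Compatible M a b → ∃ j, IsJoin M a b j
  mul_join_left : ∀ c a b j, IsJoin M a b j → IsJoin M (M.mul c a) (M.mul c b) (M.mul c j)
  mul_join_right : ∀ c a b j, IsJoin M a b j → IsJoin M (M.mul a c) (M.mul b c) (M.mul j c)
  compl_exists : ∀ e, IsIdem M e → ∃ f, IsComplPair M e f

/-- The relation `D` preserves complementation: `e D f` implies `ē D f̄`. -/
def DPreservesCompl (M : InvMonData S) : Prop :=
  ∀ e f e' f', DRel M e f → IsComplPair M e e' → IsComplPair M f f' → DRel M e' f'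

/-- `M` is completely semisimple: `e D f ≤ e` implies `e = f` for idempotents. -/
def CompletelySemisimple (M : InvMonData S) : Prop :=
  ∀ e f, IsIdem M e → IsIdem M f → DRel M e f → nle M f e → e = f

/-- A Foulis monoid: a completely semisimple Boolean inverse monoid in which `D`
preserves complementation. -/
def IsFoulis (M : InvMonData S) : Prop :=
  IsBooleanInverseMonoid M ∧ CompletelySemisimple M ∧ DPreservesCompl M

/-- The preorder underlying `S/J`: `Jle s t` iff `SsS ⊆ StS`, i.e. `s = a·t·b` for some `a, b`. -/
def Jle (M : InvMonData S) (s t : S) : Prop := ∃ a b, s = M.mul (M.mul a t) b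

/-- `S/J`, the poset of principal ideals, is a lattice. -/
def LatticeCondition (M : InvMonData S) : Prop :=
  ∀ s t : S,
    (∃ m, Jle M m s ∧ Jle M m t ∧ ∀ c, Jle M c s → Jle M c t → Jle M c m) ∧
    (∃ j, Jle M s j ∧ Jle M t j ∧ ∀ c, Jle M s c → Jle M t c → Jle M j c)

/-- `[e] ⊕ [f] = [g]` in `E(S)/D`: there are orthogonal idempotents `e' D e` and `f' D f`
whose join is `D`-related to `g`. -/
def OplusEq (M : InvMonData S) (e f g : S) : Prop :=
  ∃ e' f' j, IsIdem M e' ∧ IsIdem M f' ∧ DRel M e e' ∧ DRel M f f' ∧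
    M.mul e' f' = M.zero ∧ IsJoin M e' f' j ∧ DRel M j g

/-- `M` is fundamental: only idempotents commute with every idempotent. -/
def Fundamental (M : InvMonData S) : Prop :=
  ∀ s, (∀ e, IsIdem M e → M.mul s e = M.mul e s) → IsIdem M s

/-- `M` is factorizable: every element lies beneath a unit. -/
def Factorizable (M : InvMonData S) : Prop :=
  ∀ s, ∃ g, M.mul g (M.inv g) = M.one ∧ M.mul (M.inv g) g = M.one ∧ nle M s g

/-- All binary meets exist (`∧`-monoid). -/
def HasMeets (M : InvMonData S) : Prop := ∀ a b, ∃ m, IsMeet M a b m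

/-- A morphism of Boolean inverse `∧`-monoids: a monoid homomorphism mapping zero to zero,
preserving binary compatible joins and binary meets. -/
def IsMorphism (M : InvMonData S) (N : InvMonData T) (f : S → T) : Prop :=
  f M.one = N.one ∧ f M.zero = N.zero ∧
  (∀ a b, f (M.mul a b) = N.mul (f a) (f b)) ∧
  (∀ a b j, Compatible M a b → IsJoin M a b j → IsJoin N (f a) (f b) (f j)) ∧
  (∀ a b m, IsMeet M a b m → IsMeet N (f a) (f b) (f m))

end Coordinatization
namespace Coordinatization

/-- The data of a partial algebra: a partially defined binary operation (encoded via
`Option`) together with constants `0` and `1`. -/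
structure PartialAlg (E : Type) where
  add : E → E → Option E
  zero : E
  one : E

/-- The induced order: `a ≤ b` iff `b = a ⊕ c` for some `c`. -/
def PartialAlg.le {E : Type} (P : PartialAlg E) (a b : E) : Prop := ∃ c, P.add a c = some b

/-- An effect algebra: `⊕` is commutative and associative (as a partial operation),
`a ⊕ 1` is defined iff `a = 0`, and every element has a unique complement. -/
structure IsEffectAlgebra {E : Type} (P : PartialAlg E) : Prop where
  comm : ∀ a b, P.add a b = P.add b a
  assoc : ∀ a b c, (P.add a b).bind (fun x => P.add x c) = (P.add b c).bind (fun y => P.add a y)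
  one_def : ∀ a, (P.add a P.one).isSome ↔ a = P.zero
  compl : ∀ a, ∃! a', P.add a a' = some P.one

/-- The refinement property. -/
def HasRefinement {E : Type} (P : PartialAlg E) : Prop :=
  ∀ a₁ a₂ b₁ b₂ v, P.add a₁ a₂ = some v → P.add b₁ b₂ = some v →
    ∃ c₁₁ c₁₂ c₂₁ c₂₂, P.add c₁₁ c₁₂ = some a₁ ∧ P.add c₂₁ c₂₂ = some a₂ ∧
      P.add c₁₁ c₂₁ = some b₁ ∧ P.add c₁₂ c₂₂ = some b₂

/-- The induced order is a lattice. -/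
def LatticeOrdered {E : Type} (P : PartialAlg E) : Prop :=
  ∀ a b : E,
    (∃ m, P.le m a ∧ P.le m b ∧ ∀ c, P.le c a → P.le c b → P.le c m) ∧
    (∃ j, P.le a j ∧ P.le b j ∧ ∀ c, P.le a c → P.le b c → P.le j c)

/-- An MV-algebra: a lattice-ordered effect algebra with the refinement property. -/
def IsMV {E : Type} (P : PartialAlg E) : Prop :=
  IsEffectAlgebra P ∧ LatticeOrdered P ∧ HasRefinement P

/-- The MV-algebra `P` is co-ordinatized by the inverse monoid `M`: the map `φ` induces a
bijection between `E(S)/D = S/J` and `E` carrying `[0]` to `0`, `[1]` to `1`, the partial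
operation `⊕` on `D`-classes to the partial operation of `P`, and Boolean complementation
of `D`-classes to complementation in `P`; i.e. `S/J ≅ P` as MV-algebras. -/
def MVCoordinatizes {S E : Type} (M : InvMonData S) (P : PartialAlg E) : Prop :=
  ∃ φ : S → E,
    (∀ e f, IsIdem M e → IsIdem M f → (φ e = φ f ↔ DRel M e f)) ∧
    (∀ x : E, ∃ e, IsIdem M e ∧ φ e = x) ∧
    φ M.zero = P.zero ∧ φ M.one = P.one ∧
    (∀ e f z, IsIdem M e → IsIdem M f →
      (P.add (φ e) (φ f) = some z ↔ ∃ g, IsIdem M g ∧ OplusEq M e f g ∧ φ g = z)) ∧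
    (∀ e e', IsComplPair M e e' → P.add (φ e) (φ e') = some P.one)

end Coordinatization
namespace Coordinatization


/-- A chain of good sets in which every countably indexed requirement that is ever activated
is eventually fulfilled. -/
theorem exists_chain {α ι : Type} [Countable ι] (Good : Set α → Prop)
    (pre post : ι → Set α → Prop) (T₀ : Set α) (h₀ : Good T₀)
    (hmono : ∀ i T T', pre i T → T ⊆ T' → pre i T')
    (step : ∀ i T, Good T → pre i T → ∃ T', T ⊆ T' ∧ Good T' ∧ post i T') :
    ∃ G : ℕ → Set α, Monotone G ∧ (∀ n, Good (G n)) ∧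
      ∀ i n, pre i (G n) → ∃ k, post i (G k) := by
  classical
  rcases isEmpty_or_nonempty ι with hι | hι
  · exact ⟨fun _ => T₀, monotone_const, fun _ => h₀, fun i => isEmptyElim i⟩
  obtain ⟨e, he⟩ := exists_surjective_nat ι
  choose! F hF₁ hF₂ hF₃ using step
  let G : ℕ → Set α := fun n => Nat.rec T₀
    (fun k T => if pre (e k.unpair.1) T then F (e k.unpair.1) T else T) n
  have hG : ∀ k, G (k + 1) =
      if pre (e k.unpair.1) (G k) then F (e k.unpair.1) (G k) else G k := fun _ => rfl
  have hgood : ∀ n, Good (G n) := by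
    intro n
    induction n with
    | zero => exact h₀
    | succ k ih =>
      rw [hG]
      split_ifs with h
      · exact hF₂ _ _ ih h
      · exact ih
  have hGmono : Monotone G := by
    refine monotone_nat_of_le_succ fun k => ?_
    rw [hG]
    split_ifs with h
    · exact hF₁ _ _ (hgood k) h
    · exact le_rfl
  refine ⟨G, hGmono, hgood, fun i n hi => ?_⟩
  obtain ⟨j, rfl⟩ := he i
  refine ⟨Nat.pair j n + 1, ?_⟩
  have hp : pre (e j) (G (Nat.pair j n)) := hmono _ _ _ hi (hGmono (Nat.right_le_pair j n))
  rw [hG, Nat.unpair_pair]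
  simp only [hp, if_true]
  exact hF₃ _ _ (hgood _) hp

section FiniteFamilies

variable {A ι : Type} [BooleanAlgebra A] {x : ι → A}

theorem disjoint_sup_sup (hx : Pairwise (Function.onFun Disjoint x)) {J K : Finset ι}
    (h : Disjoint J K) : Disjoint (J.sup x) (K.sup x) := by
  rw [Finset.disjoint_sup_left]
  intro i hi
  rw [Finset.disjoint_sup_right]
  intro j hj
  exact hx (fun hij => Finset.disjoint_left.1 h hi (hij ▸ hj))

theorem compl_sup_family [Fintype ι] [DecidableEq ι] (hx : Pairwise (Function.onFun Disjoint x))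
    (htop : Finset.univ.sup x = ⊤) (J : Finset ι) : (J.sup x)ᶜ = Jᶜ.sup x := by
  refine IsCompl.compl_eq ⟨disjoint_sup_sup hx disjoint_compl_right, ?_⟩
  rw [codisjoint_iff, ← Finset.sup_union, Finset.union_compl, htop]

/-- A member of a disjoint family lying below a finite join of members of the family either
occurs in that join or vanishes. -/
theorem eq_bot_of_le_sup (hx : Pairwise (Function.onFun Disjoint x)) {i : ι} {K : Finset ι}
    (hi : i ∉ K) (h : x i ≤ K.sup x) : x i = ⊥ := by
  have := disjoint_sup_sup hx (Finset.disjoint_singleton_left.2 hi)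
  rw [Finset.sup_singleton] at this
  exact this.eq_bot_of_le h

theorem pairwise_disjoint_prod_bool (hx : Pairwise (Function.onFun Disjoint x))
    {x' : ι × Bool → A} (hle : ∀ i b, x' (i, b) ≤ x i)
    (hd : ∀ i, Disjoint (x' (i, true)) (x' (i, false))) :
    Pairwise (Function.onFun Disjoint x') := by
  rintro ⟨i, b⟩ ⟨j, c⟩ hne
  by_cases hij : i = j
  · subst hij
    cases b <;> cases c
    · exact absurd rfl hne
    · exact (hd i).symm
    · exact hd i
    · exact absurd rfl hne
  · exact (hx hij).mono (hle i b) (hle j c)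

theorem sup_product_bool {x' : ι × Bool → A} (h : ∀ i, x' (i, true) ⊔ x' (i, false) = x i)
    (J : Finset ι) : (J ×ˢ (Finset.univ : Finset Bool)).sup x' = J.sup x := by
  rw [Finset.sup_product_left]
  exact Finset.sup_congr rfl fun i _ => by simp [← h]

theorem sup_product_singleton {x' : ι × Bool → A} (b : Bool) (J : Finset ι) :
    (J ×ˢ {b}).sup x' = J.sup fun i => x' (i, b) := by
  rw [Finset.sup_product_left]
  simp

end FiniteFamilies

section MeasureConstruction

variable {M : Type} [AddCommMonoid M]

/-- Sums below `u` have the refinement property. -/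
def RefinesBelow (u : M) : Prop :=
  ∀ a₁ a₂ b₁ b₂ r : M, a₁ + a₂ = b₁ + b₂ → a₁ + a₂ + r = u →
    ∃ c₁₁ c₁₂ c₂₁ c₂₂, c₁₁ + c₁₂ = a₁ ∧ c₂₁ + c₂₂ = a₂ ∧ c₁₁ + c₂₁ = b₁ ∧ c₁₂ + c₂₂ = b₂

theorem RefinesBelow.exists_sum_split {u : M} (hu : RefinesBelow u) {ι : Type} (m : ι → M)
    (J : Finset ι) : ∀ y z r : M, ∑ i ∈ J, m i = y + z → ∑ i ∈ J, m i + r = u →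
      (∀ a b : M, a + b = 0 → a = 0 ∧ b = 0) →
      ∃ p q : ι → M, (∀ i ∈ J, p i + q i = m i) ∧ ∑ i ∈ J, p i = y ∧ ∑ i ∈ J, q i = z := by
  classical
  induction J using Finset.induction_on with
  | empty =>
    intro y z r h _ hc
    obtain ⟨rfl, rfl⟩ := hc y z (by simpa using h.symm)
    exact ⟨0, 0, by simp, by simp, by simp⟩
  | insert i J hi ih =>
    intro y z r h hr hc
    rw [Finset.sum_insert hi] at h hr
    obtain ⟨c₁₁, c₁₂, c₂₁, c₂₂, h₁, h₂, h₃, h₄⟩ := hu _ _ _ _ r h hr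
    obtain ⟨p, q, hpq, hp, hq⟩ := ih c₂₁ c₂₂ (m i + r) h₂.symm
      (by rw [← hr]; abel) hc
    have hne : ∀ j ∈ J, j ≠ i := fun j hj hji => hi (hji ▸ hj)
    refine ⟨Function.update p i c₁₁, Function.update q i c₁₂, ?_, ?_, ?_⟩
    · intro j hj
      rcases Finset.mem_insert.1 hj with rfl | hj
      · simpa using h₁
      · simpa [hne j hj] using hpq j hj
    · rw [Finset.sum_insert hi, Function.update_self, ← h₃, ← hp]
      congr 1
      exact Finset.sum_congr rfl fun j hj => by simp [hne j hj]
    · rw [Finset.sum_insert hi, Function.update_self, ← h₄, ← hq]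
      congr 1
      exact Finset.sum_congr rfl fun j hj => by simp [hne j hj]

/-- The graph of a strict `M`-valued measure of total mass `u` on a finite subalgebra of `A`. -/
def IsFiniteMeasureGraph (A : Type) [BooleanAlgebra A] (u : M) (T : Set (A × M)) : Prop :=
  ∃ (ι : Type) (_ : Fintype ι) (x : ι → A) (m : ι → M),
    Pairwise (Function.onFun Disjoint x) ∧ Finset.univ.sup x = ⊤ ∧ ∑ i, m i = u ∧
    (∀ i, x i = ⊥ ↔ m i = 0) ∧ T = {p | ∃ J : Finset ι, p = (J.sup x, ∑ i ∈ J, m i)}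

/-- The graph of a strict `M`-valued measure of total mass `u` on a subalgebra of `A`. -/
structure IsMeasureGraph {A : Type} [BooleanAlgebra A] (u : M) (T : Set (A × M)) : Prop where
  bot_mem : (⊥, 0) ∈ T
  top_mem : (⊤, u) ∈ T
  compl_mem : ∀ x m, (x, m) ∈ T → ∃ n, (xᶜ, n) ∈ T
  sup_mem : ∀ x m y n, (x, m) ∈ T → (y, n) ∈ T → ∃ k, (x ⊔ y, k) ∈ T
  add_mem : ∀ x m y n, (x, m) ∈ T → (y, n) ∈ T → Disjoint x y → (x ⊔ y, m + n) ∈ T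
  functional : ∀ x m n, (x, m) ∈ T → (x, n) ∈ T → m = n
  strict : ∀ x, (x, 0) ∈ T → x = ⊥

theorem IsFiniteMeasureGraph.isMeasureGraph {A : Type} [BooleanAlgebra A] {u : M}
    (hc : ∀ a b : M, a + b = 0 → a = 0 ∧ b = 0) {T : Set (A × M)}
    (hT : IsFiniteMeasureGraph A u T) : IsMeasureGraph u T := by
  classical
  obtain ⟨ι, _, x, m, hx, htop, hu, h0, rfl⟩ := hT
  have sum_eq : ∀ J K : Finset ι, J.sup x = K.sup x → ∑ i ∈ J, m i = ∑ i ∈ J ∩ K, m i := by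
    intro J K h
    refine (Finset.sum_subset Finset.inter_subset_left fun i hi hn => (h0 i).1 ?_).symm
    exact eq_bot_of_le_sup (K := K) hx (fun hK => hn (Finset.mem_inter.2 ⟨hi, hK⟩))
      (h ▸ Finset.le_sup hi)
  refine ⟨⟨∅, by simp⟩, ⟨Finset.univ, by rw [htop, hu]⟩, ?_, ?_, ?_, ?_, ?_⟩
  · rintro _ _ ⟨J, h⟩
    obtain ⟨rfl, rfl⟩ := Prod.mk.inj h
    exact ⟨_, Jᶜ, by rw [compl_sup_family hx htop]⟩
  · rintro _ _ _ _ ⟨J, h⟩ ⟨K, h'⟩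
    obtain ⟨rfl, rfl⟩ := Prod.mk.inj h
    obtain ⟨rfl, rfl⟩ := Prod.mk.inj h'
    exact ⟨_, J ∪ K, by rw [Finset.sup_union]⟩
  · rintro _ _ _ _ ⟨J, h⟩ ⟨K, h'⟩ hd
    obtain ⟨rfl, rfl⟩ := Prod.mk.inj h
    obtain ⟨rfl, rfl⟩ := Prod.mk.inj h'
    refine ⟨J ∪ K, ?_⟩
    have hz : ∑ i ∈ J ∩ K, m i = 0 := by
      refine Finset.sum_eq_zero fun i hi => (h0 i).1 ?_
      rw [Finset.mem_inter] at hi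
      exact disjoint_self.1 (hd.mono (Finset.le_sup hi.1) (Finset.le_sup hi.2))
    rw [Finset.sup_union, ← Finset.sum_union_inter, hz, add_zero]
  · rintro _ _ _ ⟨J, h⟩ ⟨K, h'⟩
    obtain ⟨rfl, rfl⟩ := Prod.mk.inj h
    obtain ⟨h₁, rfl⟩ := Prod.mk.inj h'
    rw [sum_eq J K h₁, sum_eq K J h₁.symm, Finset.inter_comm]
  · rintro _ ⟨J, h⟩
    obtain ⟨rfl, h₁⟩ := Prod.mk.inj h
    rw [Finset.sup_eq_bot_iff]
    intro i hi
    rw [h0]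
    rw [← Finset.add_sum_erase _ _ hi] at h₁
    exact (hc _ _ h₁.symm).1

theorem exists_disjoint_split {A : Type} [BooleanAlgebra A]
    (hA : ∀ x : A, x ≠ ⊥ → ∃ y z, Disjoint y z ∧ y ⊔ z = x ∧ y ≠ ⊥ ∧ z ≠ ⊥)
    (hc : ∀ a b : M, a + b = 0 → a = 0 ∧ b = 0) (x : A) (p q : M) (h : x = ⊥ ↔ p + q = 0) :
    ∃ y z, Disjoint y z ∧ y ⊔ z = x ∧ (y = ⊥ ↔ p = 0) ∧ (z = ⊥ ↔ q = 0) := by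
  by_cases hp : p = 0
  · subst hp
    exact ⟨⊥, x, disjoint_bot_left, by simp, by simp, by simpa using h⟩
  by_cases hq : q = 0
  · subst hq
    exact ⟨x, ⊥, disjoint_bot_right, by simp, by simpa using h, by simp⟩
  obtain ⟨y, z, h₁, h₂, h₃, h₄⟩ := hA x (fun hx => hp (hc _ _ (h.1 hx)).1)
  exact ⟨y, z, h₁, h₂, by simp [h₃, hp], by simp [h₄, hq]⟩

theorem IsFiniteMeasureGraph.exists_extension {A : Type} [BooleanAlgebra A]
    (hA : ∀ x : A, x ≠ ⊥ → ∃ y z, Disjoint y z ∧ y ⊔ z = x ∧ y ≠ ⊥ ∧ z ≠ ⊥)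
    (hc : ∀ a b : M, a + b = 0 → a = 0 ∧ b = 0) {u : M} (hu : RefinesBelow u)
    {T : Set (A × M)} (hT : IsFiniteMeasureGraph A u T) {b : A} {v w : M}
    (hb : (b, v + w) ∈ T) :
    ∃ T', T ⊆ T' ∧ IsFiniteMeasureGraph A u T' ∧
      ∃ c d, Disjoint c d ∧ c ⊔ d = b ∧ (c, v) ∈ T' ∧ (d, w) ∈ T' := by
  classical
  obtain ⟨ι, _, x, m, hx, htop, hsum, h0, rfl⟩ := hT
  obtain ⟨J, h⟩ := hb
  obtain ⟨rfl, hJ⟩ := Prod.mk.inj h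
  obtain ⟨p, q, hpq, rfl, rfl⟩ := hu.exists_sum_split m J v w (∑ i ∈ Jᶜ, m i) hJ.symm
    (by rw [Finset.sum_add_sum_compl, hsum]) hc
  let m' : ι × Bool → M := fun k =>
    if k.1 ∈ J then (if k.2 then p k.1 else q k.1) else (if k.2 then m k.1 else 0)
  have hm' : ∀ i, m' (i, true) + m' (i, false) = m i := by
    intro i
    by_cases hi : i ∈ J <;> simp [m', hi, hpq]
  have key : ∀ i, ∃ y z, Disjoint y z ∧ y ⊔ z = x i ∧ (y = ⊥ ↔ m' (i, true) = 0) ∧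
      (z = ⊥ ↔ m' (i, false) = 0) := fun i =>
    exists_disjoint_split hA hc _ _ _ (by rw [hm', h0])
  choose y z hd hyz hy hz using key
  let x' : ι × Bool → A := fun k => if k.2 then y k.1 else z k.1
  have hx' : ∀ i, x' (i, true) ⊔ x' (i, false) = x i := fun i => by simp [x', hyz]
  have hxd : Pairwise (Function.onFun Disjoint x') := by
    refine pairwise_disjoint_prod_bool hx (fun i b => ?_) (fun i => by simpa [x'] using hd i)
    rw [← hx' i]
    cases b
    · exact le_sup_right
    · exact le_sup_left
  have hsumJ : ∀ K : Finset ι, ∑ k ∈ K ×ˢ (Finset.univ : Finset Bool), m' k = ∑ i ∈ K, m i := by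
    intro K
    rw [Finset.sum_product]
    exact Finset.sum_congr rfl fun i _ => by simp [hm']
  refine ⟨_, ?_, ⟨ι × Bool, inferInstance, x', m', hxd, ?_, ?_, ?_, rfl⟩, ?_⟩
  · rintro _ ⟨K, rfl⟩
    exact ⟨K ×ˢ Finset.univ, by rw [sup_product_bool hx', hsumJ]⟩
  · rw [← Finset.univ_product_univ, sup_product_bool hx', htop]
  · rw [← Finset.univ_product_univ, hsumJ, hsum]
  · rintro ⟨i, b⟩
    cases b
    · simpa [x'] using hz i
    · simpa [x'] using hy i
  · refine ⟨(J ×ˢ {true}).sup x', (J ×ˢ {false}).sup x', ?_, ?_, ⟨J ×ˢ {true}, ?_⟩,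
      ⟨J ×ˢ {false}, ?_⟩⟩
    · refine disjoint_sup_sup hxd ?_
      rw [Finset.disjoint_product]
      simp
    · rw [sup_product_singleton, sup_product_singleton, ← Finset.sup_sup]
      exact Finset.sup_congr rfl fun i _ => hx' i
    · congr 1
      rw [Finset.sum_product]
      exact Finset.sum_congr rfl fun i hi => by simp [m', hi]
    · congr 1
      rw [Finset.sum_product]
      exact Finset.sum_congr rfl fun i hi => by simp [m', hi]

/-- Every countable conical monoid with refinement below `u` carries a homogeneous strict
measure of total mass `u` on a countable Boolean algebra. -/
theorem exists_homogeneous_measure {A : Type} [BooleanAlgebra A] [Countable A] [Countable M]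
    (hA : ∀ x : A, x ≠ ⊥ → ∃ y z, Disjoint y z ∧ y ⊔ z = x ∧ y ≠ ⊥ ∧ z ≠ ⊥)
    (hc : ∀ a b : M, a + b = 0 → a = 0 ∧ b = 0) {u : M} (hu : RefinesBelow u)
    (hAu : (⊤ : A) = ⊥ ↔ u = 0) :
    ∃ (B : BooleanSubalgebra A) (μ : B → M), μ ⊤ = u ∧
      (∀ x y, Disjoint x y → μ (x ⊔ y) = μ x + μ y) ∧ (∀ x, μ x = 0 → x = ⊥) ∧
      ∀ b v w, μ b = v + w → ∃ c d, Disjoint c d ∧ c ⊔ d = b ∧ μ c = v ∧ μ d = w := by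
  classical
  have h₀ : IsFiniteMeasureGraph A u
      {p | ∃ J : Finset Unit, p = (J.sup fun _ => (⊤ : A), ∑ _i ∈ J, u)} :=
    ⟨Unit, inferInstance, fun _ => ⊤, fun _ => u, fun i j h => absurd rfl h, by simp, by simp,
      fun _ => hAu, rfl⟩
  obtain ⟨G, hmono, hgood, hG⟩ := exists_chain (ι := A × M × M) (IsFiniteMeasureGraph A u)
    (fun i T => (i.1, i.2.1 + i.2.2) ∈ T)
    (fun i T => ∃ c d, Disjoint c d ∧ c ⊔ d = i.1 ∧ (c, i.2.1) ∈ T ∧ (d, i.2.2) ∈ T)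
    _ h₀ (fun i T T' h hT => hT h)
    (fun i T hT hi => hT.exists_extension hA hc hu hi)
  have hgr : ∀ n, IsMeasureGraph u (G n) := fun n => (hgood n).isMeasureGraph hc
  have hle : ∀ {p k l}, p ∈ G k → k ≤ l → p ∈ G l := fun h hkl => hmono hkl h
  let B : BooleanSubalgebra A :=
    { carrier := {x | ∃ m n, (x, m) ∈ G n}
      supClosed' := by
        rintro x ⟨m, k, hx⟩ y ⟨n, l, hy⟩
        obtain ⟨r, hr⟩ := (hgr (max k l)).sup_mem _ _ _ _ (hle hx (le_max_left _ _))
          (hle hy (le_max_right _ _))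
        exact ⟨r, _, hr⟩
      infClosed' := by
        rintro x ⟨m, k, hx⟩ y ⟨n, l, hy⟩
        obtain ⟨r, hr⟩ := (hgr _).compl_mem _ _ (hle hx (le_max_left k l))
        obtain ⟨s, hs⟩ := (hgr _).compl_mem _ _ (hle hy (le_max_right k l))
        obtain ⟨t, ht⟩ := (hgr _).sup_mem _ _ _ _ hr hs
        obtain ⟨v, hv⟩ := (hgr _).compl_mem _ _ ht
        exact ⟨v, _, by simpa using hv⟩
      compl_mem' := by
        rintro x ⟨m, k, hx⟩
        obtain ⟨r, hr⟩ := (hgr k).compl_mem _ _ hx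
        exact ⟨r, k, hr⟩
      bot_mem' := ⟨0, 0, (hgr 0).bot_mem⟩ }
  have hB : ∀ x : B, ∃ m n, ((x : A), m) ∈ G n := fun x => x.2
  choose μ N hμ using hB
  have hval : ∀ (x : B) m n, ((x : A), m) ∈ G n → μ x = m := fun x m n h =>
    (hgr (max (N x) n)).functional _ _ _ (hle (hμ x) (le_max_left _ _))
      (hle h (le_max_right _ _))
  have hdis : ∀ x y : B, Disjoint x y ↔ Disjoint (x : A) y := fun x y => by
    rw [disjoint_iff, disjoint_iff, ← Subtype.coe_inj]
    simp
  refine ⟨B, μ, hval _ _ 0 (hgr 0).top_mem, fun x y hxy => ?_, fun x hx => ?_,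
    fun b v w h => ?_⟩
  · exact hval _ _ _ ((hgr (max (N x) (N y))).add_mem _ _ _ _
      (hle (hμ x) (le_max_left _ _)) (hle (hμ y) (le_max_right _ _)) ((hdis x y).1 hxy))
  · have := hμ x
    rw [hx] at this
    exact Subtype.ext ((hgr _).strict _ this)
  · have hb := hμ b
    rw [h] at hb
    obtain ⟨k, c, d, hcd, hb', hcm, hdm⟩ := hG ((b : A), v, w) _ hb
    refine ⟨⟨c, _, _, hcm⟩, ⟨d, _, _, hdm⟩, (hdis _ _).2 hcd, Subtype.ext hb',
      hval _ _ _ hcm, hval _ _ _ hdm⟩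

end MeasureConstruction

section AtomlessAlgebra

theorem exists_clopens_split (x : TopologicalSpace.Clopens (ℕ → Bool)) (hx : x ≠ ⊥) :
    ∃ y z : TopologicalSpace.Clopens (ℕ → Bool),
      Disjoint y z ∧ y ⊔ z = x ∧ y ≠ ⊥ ∧ z ≠ ⊥ := by
  have hne : ∃ f, f ∈ x := by
    by_contra! h
    exact hx (SetLike.ext fun f => ⟨fun hf => absurd hf (h f), fun hf => False.elim hf⟩)
  obtain ⟨f, hf⟩ := hne
  have ht : Filter.Tendsto (fun n => Function.update f n (!f n)) Filter.atTop (nhds f) := by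
    rw [tendsto_pi_nhds]
    intro i
    refine tendsto_const_nhds.congr' ?_
    filter_upwards [Filter.eventually_gt_atTop i] with n hn
    rw [Function.update_of_ne hn.ne]
  obtain ⟨n, hn⟩ := (ht.eventually (x.isOpen.mem_nhds hf)).exists
  let v : TopologicalSpace.Clopens (ℕ → Bool) :=
    ⟨(fun g => g n) ⁻¹' {f n}, (isClopen_discrete _).preimage (continuous_apply n)⟩
  have hv : ∀ g, g ∈ v ↔ g n = f n := fun g => Iff.rfl
  refine ⟨x ⊓ v, x \ v, disjoint_inf_sdiff, sup_inf_sdiff x v, fun h => ?_, fun h => ?_⟩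
  · have : f ∈ x ⊓ v := ⟨hf, (hv f).2 rfl⟩
    rw [h] at this
    exact this
  · have : Function.update f n (!f n) ∈ x \ v := ⟨hn, fun h' => by simpa using (hv _).1 h'⟩
    rw [h] at this
    exact this

instance : Countable (TopologicalSpace.Clopens (ℕ → Bool)) :=
  TopologicalSpace.Clopens.countable_iff_secondCountable.2 inferInstance

end AtomlessAlgebra

section EffectAlgebra

variable {E : Type} {P : PartialAlg E}

namespace IsEffectAlgebra

theorem one_add_zero (h : IsEffectAlgebra P) : P.add P.one P.zero = some P.one := by
  obtain ⟨a, ha, -⟩ := h.compl P.one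
  have : a = P.zero := (h.one_def a).1 (by rw [h.comm, ha]; rfl)
  rwa [this] at ha

theorem add_assoc_of_eq (h : IsEffectAlgebra P) {a b c x v : E} (hx : P.add a b = some x)
    (hv : P.add x c = some v) : ∃ y, P.add b c = some y ∧ P.add a y = some v := by
  have := h.assoc a b c
  rw [hx, Option.bind_some, hv] at this
  exact Option.bind_eq_some_iff.1 this.symm

theorem add_left_cancel (h : IsEffectAlgebra P) {a b c v : E} (hb : P.add a b = some v)
    (hc : P.add a c = some v) : b = c := by
  obtain ⟨w, hw, -⟩ := h.compl v
  rw [h.comm] at hb hc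
  obtain ⟨y, hy, hby⟩ := h.add_assoc_of_eq hb hw
  obtain ⟨z, hz, hcz⟩ := h.add_assoc_of_eq hc hw
  rw [hy] at hz
  obtain rfl := Option.some.inj hz
  rw [h.comm] at hby hcz
  exact (h.compl y).unique hby hcz

theorem add_zero (h : IsEffectAlgebra P) (a : E) : P.add a P.zero = some a := by
  obtain ⟨b, hb, -⟩ := h.compl a
  rw [h.comm] at hb
  obtain ⟨y, hy, hby⟩ := h.add_assoc_of_eq hb h.one_add_zero
  rwa [(h.compl b).unique hby hb] at hy

theorem zero_of_add_eq_zero (h : IsEffectAlgebra P) {a b : E} (hab : P.add a b = some P.zero) :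
    b = P.zero := by
  have h1 : P.add P.zero P.one = some P.one := by rw [h.comm, h.one_add_zero]
  obtain ⟨y, hy, -⟩ := h.add_assoc_of_eq hab h1
  exact (h.one_def b).1 (by rw [hy]; rfl)

/-- The one-point extension of an effect algebra to a commutative monoid: undefined sums are
sent to `none`. -/
@[reducible] def optionAddCommMonoid (h : IsEffectAlgebra P) : AddCommMonoid (Option E) where
  add x y := x.bind fun a => y.bind fun b => P.add a b
  zero := some P.zero
  add_assoc := by
    rintro (_ | a) (_ | b) (_ | c)
    · rfl
    · rfl
    · rfl
    · rfl
    · rfl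
    · rfl
    · change (P.add a b).bind (fun _ => none) = none
      cases P.add a b <;> rfl
    · change (P.add a b).bind (fun x => P.add x c) = (P.add b c).bind (fun y => P.add a y)
      exact h.assoc a b c
  zero_add := by
    rintro (_ | a)
    · rfl
    · exact (h.comm _ _).trans (h.add_zero a)
  add_zero := by
    rintro (_ | a)
    · rfl
    · exact h.add_zero a
  add_comm := by
    rintro (_ | a) (_ | b)
    · rfl
    · rfl
    · rfl
    · exact h.comm a b
  nsmul := @nsmulRec _ ⟨some P.zero⟩ ⟨fun x y => x.bind fun a => y.bind fun b => P.add a b⟩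
  nsmul_zero _ := rfl
  nsmul_succ _ _ := rfl

end IsEffectAlgebra

/-- A strict homogeneous measure on a Boolean algebra with values in a partial algebra. -/
structure IsVaughtMeasure {B : Type} [BooleanAlgebra B] (P : PartialAlg E) (m : B → E) :
    Prop where
  top : m ⊤ = P.one
  add : ∀ x y, Disjoint x y → P.add (m x) (m y) = some (m (x ⊔ y))
  strict : ∀ x, m x = P.zero → x = ⊥
  split : ∀ b v w, P.add v w = some (m b) →
    ∃ c d, Disjoint c d ∧ c ⊔ d = b ∧ m c = v ∧ m d = w

theorem exists_vaughtMeasure_of_algebra [Countable E] (h : IsEffectAlgebra P)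
    (hr : HasRefinement P) {A : Type} [BooleanAlgebra A] [Countable A]
    (hA : ∀ x : A, x ≠ ⊥ → ∃ y z, Disjoint y z ∧ y ⊔ z = x ∧ y ≠ ⊥ ∧ z ≠ ⊥)
    (hAu : (⊤ : A) = ⊥ ↔ P.one = P.zero) :
    ∃ (B : Type) (_ : BooleanAlgebra B) (_ : Countable B) (m : B → E),
      IsVaughtMeasure P m := by
  let _ := h.optionAddCommMonoid
  have add_def : ∀ a b : E, (some a + some b : Option E) = P.add a b := fun _ _ => rfl
  have add_some : ∀ (x y : Option E) (c : E), x + y = some c →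
      ∃ a b, x = some a ∧ y = some b ∧ P.add a b = some c := by
    rintro (_ | a) (_ | b) c hc
    · cases hc
    · cases hc
    · cases hc
    · exact ⟨a, b, rfl, rfl, hc⟩
  have hc : ∀ a b : Option E, a + b = 0 → a = 0 ∧ b = 0 := by
    intro a b hab
    obtain ⟨a, b, rfl, rfl, hz⟩ := add_some _ _ _ hab
    have hb := h.zero_of_add_eq_zero hz
    rw [h.comm] at hz
    have ha := h.zero_of_add_eq_zero hz
    rw [ha, hb]
    exact ⟨rfl, rfl⟩
  have hu : RefinesBelow (some P.one : Option E) := by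
    intro a₁ a₂ b₁ b₂ r hab hsum
    obtain ⟨v, -, hv, -⟩ := add_some _ _ _ hsum
    rw [hv] at hab
    obtain ⟨a₁, a₂, rfl, rfl, ha⟩ := add_some _ _ _ hv
    obtain ⟨b₁, b₂, rfl, rfl, hb⟩ := add_some _ _ _ hab.symm
    obtain ⟨c₁₁, c₁₂, c₂₁, c₂₂, h₁, h₂, h₃, h₄⟩ := hr _ _ _ _ _ ha hb
    exact ⟨some c₁₁, some c₁₂, some c₂₁, some c₂₂, h₁, h₂, h₃, h₄⟩
  have hAu' : (⊤ : A) = ⊥ ↔ (some P.one : Option E) = 0 :=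
    hAu.trans ⟨fun h => congrArg some h, fun h => Option.some.inj h⟩
  obtain ⟨B, μ, htop, hadd, hstrict, hsplit⟩ := exists_homogeneous_measure hA hc hu hAu'
  have hsome : ∀ x, ∃ a, μ x = some a := by
    intro x
    have := hadd x xᶜ disjoint_compl_right
    rw [sup_compl_eq_top, htop] at this
    obtain ⟨a, _, ha, -⟩ := add_some _ _ _ this.symm
    exact ⟨a, ha⟩
  choose m hm using hsome
  refine ⟨B, inferInstance, inferInstance, m, ?_, fun x y hxy => ?_, fun x hx => ?_,
    fun b v w hb => ?_⟩
  · exact Option.some.inj ((hm ⊤).symm.trans htop)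
  · rw [← hm, hadd x y hxy, hm, hm, add_def]
  · exact hstrict x (by rw [hm, hx]; rfl)
  · obtain ⟨c, d, h₁, h₂, h₃, h₄⟩ := hsplit b (some v) (some w) (by rw [hm, add_def, hb])
    exact ⟨c, d, h₁, h₂, Option.some.inj ((hm c).symm.trans h₃),
      Option.some.inj ((hm d).symm.trans h₄)⟩

theorem exists_vaughtMeasure [Countable E] (h : IsEffectAlgebra P) (hr : HasRefinement P) :
    ∃ (B : Type) (_ : BooleanAlgebra B) (_ : Countable B) (m : B → E),
      IsVaughtMeasure P m := by
  by_cases h01 : P.one = P.zero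
  · exact exists_vaughtMeasure_of_algebra h hr (A := PUnit)
      (fun x hx => absurd (Subsingleton.elim x ⊥) hx) (by simp [h01])
  · refine exists_vaughtMeasure_of_algebra h hr exists_clopens_split ?_
    refine iff_of_false (fun htop => ?_) h01
    have : (fun _ => true : ℕ → Bool) ∈ (⊤ : TopologicalSpace.Clopens (ℕ → Bool)) := trivial
    rw [htop] at this
    exact this

end EffectAlgebra

namespace IsVaughtMeasure

variable {E B : Type} [BooleanAlgebra B] {P : PartialAlg E} {m : B → E}

theorem map_bot (hm : IsVaughtMeasure P m) (h : IsEffectAlgebra P) : m ⊥ = P.zero := by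
  have := hm.add ⊥ ⊥ disjoint_bot_left
  rw [sup_bot_eq] at this
  exact h.add_left_cancel this (h.add_zero _)

theorem le_of_le (hm : IsVaughtMeasure P m) {x y : B} (hxy : x ≤ y) : P.le (m x) (m y) :=
  ⟨m (y \ x), by rw [hm.add _ _ disjoint_sdiff_self_right, sup_sdiff_cancel_right hxy]⟩

theorem eq_of_le (hm : IsVaughtMeasure P m) (h : IsEffectAlgebra P) {x y : B} (hxy : x ≤ y)
    (he : m x = m y) : x = y := by
  have := hm.add x (y \ x) disjoint_sdiff_self_right
  rw [sup_sdiff_cancel_right hxy, ← he] at this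
  have h0 := hm.strict _ (h.add_left_cancel this (h.add_zero _))
  exact le_antisymm hxy (sdiff_eq_bot_iff.1 h0)

theorem map_compl_eq (hm : IsVaughtMeasure P m) (h : IsEffectAlgebra P) {x y : B}
    (he : m x = m y) : m xᶜ = m yᶜ := by
  have h₁ := hm.add x xᶜ disjoint_compl_right
  have h₂ := hm.add y yᶜ disjoint_compl_right
  rw [sup_compl_eq_top] at h₁ h₂
  exact h.add_left_cancel h₁ (he ▸ h₂)

theorem exists_le_of_le (hm : IsVaughtMeasure P m) {v : E} {b : B} (h : P.le v (m b)) :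
    ∃ c ≤ b, m c = v := by
  obtain ⟨w, hw⟩ := h
  obtain ⟨c, d, -, hcd, hc, -⟩ := hm.split b v w hw
  exact ⟨c, hcd ▸ le_sup_left, hc⟩

theorem surjective (hm : IsVaughtMeasure P m) (h : IsEffectAlgebra P) :
    Function.Surjective m := by
  intro v
  obtain ⟨w, hw, -⟩ := h.compl v
  obtain ⟨c, -, hc⟩ := hm.exists_le_of_le (b := ⊤) ⟨w, by rw [hw, hm.top]⟩
  exact ⟨c, hc⟩

end IsVaughtMeasure

/-- A measure-preserving isomorphism between principal ideals of a Boolean algebra. The maps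
are extended to the whole algebra by restricting their arguments, so that `toFun` goes from the
ideal below `invFun ⊤` to the ideal below `toFun ⊤`. -/
@[ext] structure PartialIso {B E : Type} [BooleanAlgebra B] (m : B → E) where
  toFun : B → B
  invFun : B → B
  map_sup : ∀ x y, toFun (x ⊔ y) = toFun x ⊔ toFun y
  inv_sup : ∀ x y, invFun (x ⊔ y) = invFun x ⊔ invFun y
  inv_map : ∀ x, invFun (toFun x) = x ⊓ invFun ⊤
  map_inv : ∀ x, toFun (invFun x) = x ⊓ toFun ⊤
  measure_map : ∀ x, m (toFun x) = m (x ⊓ invFun ⊤)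

section BackAndForth

variable {E B : Type} [BooleanAlgebra B] {P : PartialAlg E} {m : B → E}

/-- A finite partial measure-preserving isomorphism between the ideals below `a` and `b`. -/
def IsFiniteMatching (m : B → E) (a b : B) (T : Set (B × B)) : Prop :=
  ∃ (ι : Type) (_ : Fintype ι) (x y : ι → B),
    Pairwise (Function.onFun Disjoint x) ∧ Pairwise (Function.onFun Disjoint y) ∧
    Finset.univ.sup x = a ∧ Finset.univ.sup y = b ∧ (∀ i, m (x i) = m (y i)) ∧
    T = {p | ∃ J : Finset ι, p = (J.sup x, J.sup y)}

/-- A partial measure-preserving isomorphism between the ideals below `a` and `b`. -/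
structure IsMatching (m : B → E) (a b : B) (T : Set (B × B)) : Prop where
  top_mem : (a, b) ∈ T
  sup_mem : ∀ p q, p ∈ T → q ∈ T → p ⊔ q ∈ T
  le_iff : ∀ p q, p ∈ T → q ∈ T → (p.1 ≤ q.1 ↔ p.2 ≤ q.2)
  le_left : ∀ p ∈ T, p.1 ≤ a
  le_right : ∀ p ∈ T, p.2 ≤ b
  measure_eq : ∀ p ∈ T, m p.1 = m p.2

theorem IsVaughtMeasure.sup_eq_sup (hm : IsVaughtMeasure P m) {ι : Type} {x y : ι → B}
    (hx : Pairwise (Function.onFun Disjoint x)) (hy : Pairwise (Function.onFun Disjoint y))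
    (hxy : ∀ i, m (x i) = m (y i)) (J : Finset ι) : m (J.sup x) = m (J.sup y) := by
  classical
  induction J using Finset.induction_on with
  | empty => simp
  | insert i J hi ih =>
    have hd : ∀ z : ι → B, Pairwise (Function.onFun Disjoint z) → Disjoint (z i) (J.sup z) :=
      fun z hz => by
        simpa using disjoint_sup_sup hz (Finset.disjoint_singleton_left.2 hi)
    rw [Finset.sup_insert, Finset.sup_insert]
    refine Option.some.inj ?_
    rw [← hm.add _ _ (hd x hx), ← hm.add _ _ (hd y hy), hxy, ih]

theorem IsFiniteMatching.isMatching (hm : IsVaughtMeasure P m) (h : IsEffectAlgebra P)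
    {a b : B} {T : Set (B × B)} (hT : IsFiniteMatching m a b T) : IsMatching m a b T := by
  classical
  obtain ⟨ι, _, x, y, hx, hy, rfl, rfl, hxy, rfl⟩ := hT
  have aux : ∀ z w : ι → B, Pairwise (Function.onFun Disjoint z) → (∀ i, m (z i) = m (w i)) →
      ∀ J K : Finset ι, J.sup z ≤ K.sup z → J.sup w ≤ K.sup w := by
    intro z w hz hzw J K hJK
    refine Finset.sup_le fun i hi => ?_
    by_cases hK : i ∈ K
    · exact Finset.le_sup hK
    · have h0 := eq_bot_of_le_sup hz hK ((Finset.le_sup hi).trans hJK)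
      rw [hm.strict (w i) (by rw [← hzw, h0, hm.map_bot h])]
      exact bot_le
  refine ⟨⟨Finset.univ, rfl⟩, ?_, ?_, ?_, ?_, ?_⟩
  · rintro _ _ ⟨J, rfl⟩ ⟨K, rfl⟩
    exact ⟨J ∪ K, by rw [Finset.sup_union, Finset.sup_union]; rfl⟩
  · rintro _ _ ⟨J, rfl⟩ ⟨K, rfl⟩
    exact ⟨aux x y hx hxy J K, aux y x hy (fun i => (hxy i).symm) J K⟩
  · rintro _ ⟨J, rfl⟩
    exact Finset.sup_mono (Finset.subset_univ J)
  · rintro _ ⟨J, rfl⟩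
    exact Finset.sup_mono (Finset.subset_univ J)
  · rintro _ ⟨J, rfl⟩
    exact hm.sup_eq_sup hx hy hxy J

theorem IsFiniteMatching.exists_extension (hm : IsVaughtMeasure P m)
    {a b : B} {T : Set (B × B)} (hT : IsFiniteMatching m a b T) (c : B) :
    ∃ T', T ⊆ T' ∧ IsFiniteMatching m a b T' ∧ ∃ d, (c ⊓ a, d) ∈ T' := by
  classical
  obtain ⟨ι, _, x, y, hx, hy, rfl, rfl, hxy, rfl⟩ := hT
  have key : ∀ i, ∃ v w, Disjoint v w ∧ v ⊔ w = y i ∧ m v = m (x i ⊓ c) ∧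
      m w = m (x i \ c) := fun i =>
    hm.split _ _ _ (by rw [hm.add _ _ disjoint_inf_sdiff, sup_inf_sdiff, hxy])
  choose v w hd hvw hv hw using key
  let x' : ι × Bool → B := fun k => if k.2 then x k.1 ⊓ c else x k.1 \ c
  let y' : ι × Bool → B := fun k => if k.2 then v k.1 else w k.1
  have hx' : ∀ i, x' (i, true) ⊔ x' (i, false) = x i := fun i => by simp [x']
  have hy' : ∀ i, y' (i, true) ⊔ y' (i, false) = y i := fun i => by simp [y', hvw]
  have hxd : Pairwise (Function.onFun Disjoint x') := by
    refine pairwise_disjoint_prod_bool hx (fun i b => ?_) fun i => ?_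
    · rw [← hx' i]
      cases b
      · exact le_sup_right
      · exact le_sup_left
    · simpa [x'] using disjoint_inf_sdiff
  have hyd : Pairwise (Function.onFun Disjoint y') := by
    refine pairwise_disjoint_prod_bool hy (fun i b => ?_) fun i => by simpa [y'] using hd i
    rw [← hy' i]
    cases b
    · exact le_sup_right
    · exact le_sup_left
  refine ⟨_, ?_, ⟨ι × Bool, inferInstance, x', y', hxd, hyd, ?_, ?_, ?_, rfl⟩, ?_⟩
  · rintro _ ⟨K, rfl⟩
    exact ⟨K ×ˢ Finset.univ, by rw [sup_product_bool hx', sup_product_bool hy']⟩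
  · rw [← Finset.univ_product_univ, sup_product_bool hx']
  · rw [← Finset.univ_product_univ, sup_product_bool hy']
  · rintro ⟨i, b⟩
    cases b
    · simpa [x', y'] using (hw i).symm
    · simpa [x', y'] using (hv i).symm
  · refine ⟨(Finset.univ ×ˢ {true}).sup y', Finset.univ ×ˢ {true}, ?_⟩
    congr 1
    rw [sup_product_singleton, inf_comm, Finset.sup_inf_distrib_right]
    simp [x']

theorem IsFiniteMatching.swap {a b : B} {T : Set (B × B)} (hT : IsFiniteMatching m a b T) :
    IsFiniteMatching m b a (Prod.swap ⁻¹' T) := by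
  obtain ⟨ι, _, x, y, hx, hy, ha, hb, hxy, rfl⟩ := hT
  refine ⟨ι, inferInstance, y, x, hy, hx, hb, ha, fun i => (hxy i).symm, ?_⟩
  ext ⟨p, q⟩
  simp [and_comm]

/-- Elements of equal measure are related by a measure-preserving isomorphism. -/
theorem IsVaughtMeasure.exists_partialIso [Countable B] (hm : IsVaughtMeasure P m)
    (h : IsEffectAlgebra P) {a b : B} (hab : m a = m b) :
    ∃ s : PartialIso m, s.invFun ⊤ = a ∧ s.toFun ⊤ = b := by
  classical
  have h₀ : IsFiniteMatching m a b
      {p | ∃ J : Finset Unit, p = (J.sup fun _ => a, J.sup fun _ => b)} :=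
    ⟨Unit, inferInstance, fun _ => a, fun _ => b, fun i j h => absurd rfl h,
      fun i j h => absurd rfl h, by simp, by simp, fun _ => hab, rfl⟩
  obtain ⟨G, hmono, hgood, hG⟩ := exists_chain (ι := B) (IsFiniteMatching m a b)
    (fun _ _ => True)
    (fun c T => (∃ d, (c ⊓ a, d) ∈ T) ∧ ∃ d, (d, c ⊓ b) ∈ T) _ h₀ (fun _ _ _ _ _ => trivial)
    (fun c T hT _ => by
      obtain ⟨T₁, hT₁, hg₁, d, hd⟩ := hT.exists_extension hm c
      obtain ⟨T₂, hT₂, hg₂, e, he⟩ := hg₁.swap.exists_extension hm c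
      refine ⟨Prod.swap ⁻¹' T₂, fun p hp => hT₂ (by simpa using hT₁ hp), hg₂.swap,
        ⟨d, hT₂ (by simpa using hd)⟩, ⟨e, he⟩⟩)
  have hT : IsMatching m a b (⋃ n, G n) := by
    have hgr : ∀ n, IsMatching m a b (G n) := fun n => (hgood n).isMatching hm h
    have hpair : ∀ p q, p ∈ ⋃ n, G n → q ∈ ⋃ n, G n → ∃ n, p ∈ G n ∧ q ∈ G n := by
      intro p q hp hq
      obtain ⟨k, hk⟩ := Set.mem_iUnion.1 hp
      obtain ⟨l, hl⟩ := Set.mem_iUnion.1 hq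
      exact ⟨max k l, hmono (le_max_left k l) hk, hmono (le_max_right k l) hl⟩
    refine ⟨Set.mem_iUnion.2 ⟨0, (hgr 0).top_mem⟩, fun p q hp hq => ?_, fun p q hp hq => ?_,
      fun p hp => ?_, fun p hp => ?_, fun p hp => ?_⟩
    · obtain ⟨n, h₁, h₂⟩ := hpair p q hp hq
      exact Set.mem_iUnion.2 ⟨n, (hgr n).sup_mem p q h₁ h₂⟩
    · obtain ⟨n, h₁, h₂⟩ := hpair p q hp hq
      exact (hgr n).le_iff p q h₁ h₂
    · obtain ⟨n, h₁⟩ := Set.mem_iUnion.1 hp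
      exact (hgr n).le_left p h₁
    · obtain ⟨n, h₁⟩ := Set.mem_iUnion.1 hp
      exact (hgr n).le_right p h₁
    · obtain ⟨n, h₁⟩ := Set.mem_iUnion.1 hp
      exact (hgr n).measure_eq p h₁
  have hleft : ∀ c, ∃ d, (c ⊓ a, d) ∈ ⋃ n, G n := fun c => by
    obtain ⟨k, ⟨d, hd⟩, -⟩ := hG c 0 trivial
    exact ⟨d, Set.mem_iUnion.2 ⟨k, hd⟩⟩
  have hright : ∀ c, ∃ d, (d, c ⊓ b) ∈ ⋃ n, G n := fun c => by
    obtain ⟨k, -, d, hd⟩ := hG c 0 trivial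
    exact ⟨d, Set.mem_iUnion.2 ⟨k, hd⟩⟩
  choose f hf using hleft
  choose g hg using hright
  have eqr : ∀ {c d e}, (c, d) ∈ ⋃ n, G n → (c, e) ∈ ⋃ n, G n → d = e := fun h₁ h₂ =>
    le_antisymm ((hT.le_iff _ _ h₁ h₂).1 le_rfl) ((hT.le_iff _ _ h₂ h₁).1 le_rfl)
  have eql : ∀ {c d e}, (d, c) ∈ ⋃ n, G n → (e, c) ∈ ⋃ n, G n → d = e := fun h₁ h₂ =>
    le_antisymm ((hT.le_iff _ _ h₁ h₂).2 le_rfl) ((hT.le_iff _ _ h₂ h₁).2 le_rfl)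
  have hg₁ : g ⊤ = a := eql (by simpa using hg ⊤) hT.top_mem
  have hf₁ : f ⊤ = b := eqr (by simpa using hf ⊤) hT.top_mem
  refine ⟨⟨f, g, fun x y => ?_, fun x y => ?_, fun x => ?_, fun x => ?_, fun x => ?_⟩, hg₁, hf₁⟩
  · have := hT.sup_mem _ _ (hf x) (hf y)
    rw [Prod.mk_sup_mk, ← inf_sup_right] at this
    exact eqr (hf _) this
  · have := hT.sup_mem _ _ (hg x) (hg y)
    rw [Prod.mk_sup_mk, ← inf_sup_right] at this
    exact eql (hg _) this
  · have := hg (f x)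
    rw [inf_eq_left.2 (hT.le_right _ (hf x))] at this
    rw [hg₁]
    exact eql this (hf x)
  · have := hf (g x)
    rw [inf_eq_left.2 (hT.le_left _ (hg x))] at this
    rw [hf₁]
    exact eqr this (hg x)
  · rw [hg₁]
    exact (hT.measure_eq _ (hf x)).symm

end BackAndForth

namespace PartialIso

variable {E B : Type} [BooleanAlgebra B] {m : B → E}

theorem map_mono (s : PartialIso m) {x y : B} (h : x ≤ y) : s.toFun x ≤ s.toFun y := by
  rw [← sup_eq_right.2 h, s.map_sup]
  exact le_sup_left

theorem map_inv_top (s : PartialIso m) : s.toFun (s.invFun ⊤) = s.toFun ⊤ := by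
  rw [s.map_inv, top_inf_eq]

theorem map_le_top (s : PartialIso m) (x : B) : s.toFun x ≤ s.toFun ⊤ := s.map_mono le_top

/-- The inverse partial isomorphism. -/
def symm (s : PartialIso m) : PartialIso m where
  toFun := s.invFun
  invFun := s.toFun
  map_sup := s.inv_sup
  inv_sup := s.map_sup
  inv_map := s.map_inv
  map_inv := s.inv_map
  measure_map y := by
    have hle : s.invFun y ≤ s.invFun ⊤ := by
      rw [← sup_eq_right.2 (le_top : y ≤ ⊤), s.inv_sup]
      exact le_sup_left
    rw [← s.map_inv, s.measure_map, inf_eq_left.2 hle]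

theorem inv_mono (s : PartialIso m) {x y : B} (h : x ≤ y) : s.invFun x ≤ s.invFun y :=
  s.symm.map_mono h

theorem inv_le_top (s : PartialIso m) (x : B) : s.invFun x ≤ s.invFun ⊤ := s.inv_mono le_top

theorem map_bot (s : PartialIso m) : s.toFun ⊥ = ⊥ := by
  have h : s.toFun (s.invFun ⊥) = ⊥ := by rw [s.map_inv, bot_inf_eq]
  exact le_bot_iff.1 ((s.map_mono bot_le).trans h.le)

theorem map_inf (s : PartialIso m) (x y : B) : s.toFun (x ⊓ y) = s.toFun x ⊓ s.toFun y := by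
  refine le_antisymm (le_inf (s.map_mono inf_le_left) (s.map_mono inf_le_right)) ?_
  have h : s.toFun (s.invFun (s.toFun x ⊓ s.toFun y)) = s.toFun x ⊓ s.toFun y := by
    rw [s.map_inv]
    exact inf_eq_left.2 (inf_le_left.trans (s.map_le_top x))
  rw [← h]
  refine s.map_mono (le_inf ?_ ?_)
  · exact (s.inv_mono inf_le_left).trans (by rw [s.inv_map]; exact inf_le_left)
  · exact (s.inv_mono inf_le_right).trans (by rw [s.inv_map]; exact inf_le_left)

theorem map_inf_inv_top (s : PartialIso m) (x : B) : s.toFun (x ⊓ s.invFun ⊤) = s.toFun x := by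
  rw [← s.inv_map, s.map_inv]
  exact inf_eq_left.2 (s.map_le_top x)

theorem map_eq_bot (s : PartialIso m) {x : B} (hx : x ≤ s.invFun ⊤) (h : s.toFun x = ⊥) :
    x = ⊥ := by
  rw [← inf_eq_left.2 hx, ← s.inv_map, h]
  exact s.symm.map_bot

theorem ext_of_map {s t : PartialIso m} (h : ∀ x, s.toFun x = t.toFun x) : s = t := by
  have aux : ∀ {s t : PartialIso m}, (∀ x, s.toFun x = t.toFun x) →
      ∀ y, s.invFun y ≤ t.invFun y := by
    intro s t h y
    have h₁ : t.toFun (s.invFun y) = t.toFun (t.invFun y) := by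
      rw [← h, s.map_inv, t.map_inv, h]
    have h₂ : t.toFun (s.invFun ⊤) = s.toFun ⊤ := by rw [← h, s.map_inv_top]
    have h₃ := congrArg s.invFun (h (t.invFun y))
    rw [t.map_inv, ← h, s.inv_map] at h₃
    have h₄ : s.invFun (y ⊓ s.toFun ⊤) = s.invFun y := s.symm.map_inf_inv_top y
    rw [h₄] at h₃
    exact h₃ ▸ inf_le_left
  exact PartialIso.ext (funext h)
    (funext fun y => le_antisymm (aux h y) (aux (fun x => (h x).symm) y))

/-- The identity of the ideal below `a`. -/
def res (m : B → E) (a : B) : PartialIso m where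
  toFun x := x ⊓ a
  invFun x := x ⊓ a
  map_sup x y := inf_sup_right x y a
  inv_sup x y := inf_sup_right x y a
  inv_map x := by simp
  map_inv x := by simp
  measure_map x := by simp

@[simp] theorem res_toFun (a x : B) : (res m a).toFun x = x ⊓ a := rfl

@[simp] theorem res_invFun (a x : B) : (res m a).invFun x = x ⊓ a := rfl

instance : Monoid (PartialIso m) where
  mul s t :=
    { toFun := fun x => s.toFun (t.toFun x)
      invFun := fun x => t.invFun (s.invFun x)
      map_sup := fun x y => by rw [t.map_sup, s.map_sup]
      inv_sup := fun x y => by rw [s.inv_sup, t.inv_sup]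
      inv_map := fun x => by
        rw [s.inv_map]
        change t.symm.toFun _ = _ ⊓ t.symm.toFun _
        rw [t.symm.map_inf]
        change t.invFun (t.toFun x) ⊓ _ = _
        rw [t.inv_map, inf_assoc]
        congr 1
        exact inf_eq_right.2 (t.inv_le_top _)
      map_inv := fun x => by
        rw [t.map_inv, s.map_inf, s.map_inv, inf_assoc]
        congr 1
        exact inf_eq_right.2 (s.map_le_top _)
      measure_map := fun x => by
        rw [s.measure_map, ← t.map_inf_inv_top x]
        have h : t.toFun (x ⊓ t.invFun ⊤) ⊓ s.invFun ⊤ =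
            t.toFun (x ⊓ t.invFun (s.invFun ⊤)) := by
          rw [t.map_inf_inv_top, t.map_inf, t.map_inv, inf_left_comm, ← inf_assoc,
            inf_comm (s.invFun ⊤), inf_assoc, inf_comm (s.invFun ⊤), ← inf_assoc,
            inf_eq_left.2 (t.map_le_top x)]
        rw [h, t.measure_map, inf_assoc, inf_eq_left.2 (t.inv_le_top _)] }
  one := res m ⊤
  mul_assoc _ _ _ := rfl
  one_mul s := ext_of_map fun x => inf_top_eq _
  mul_one s := ext_of_map fun x => congrArg s.toFun (inf_top_eq x)

@[simp] theorem mul_toFun (s t : PartialIso m) (x : B) :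
    (s * t).toFun x = s.toFun (t.toFun x) := rfl

@[simp] theorem mul_invFun (s t : PartialIso m) (x : B) :
    (s * t).invFun x = t.invFun (s.invFun x) := rfl

@[simp] theorem symm_toFun (s : PartialIso m) (x : B) : s.symm.toFun x = s.invFun x := rfl

theorem symm_mul_self (s : PartialIso m) : s.symm * s = res m (s.invFun ⊤) :=
  ext_of_map s.inv_map

theorem mul_symm_self (s : PartialIso m) : s * s.symm = res m (s.toFun ⊤) :=
  ext_of_map s.map_inv

theorem res_mul_res (a b : B) : res m a * res m b = res m (a ⊓ b) :=
  ext_of_map fun x => by simp [inf_assoc, inf_comm a]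

theorem res_mul_res_self (a : B) : res m a * res m a = res m a := by
  rw [res_mul_res, inf_idem]

theorem res_injective {a b : B} (h : res m a = res m b) : a = b := by
  simpa using congrArg (fun s => s.toFun ⊤) h

theorem eq_res_of_idem {s : PartialIso m} (h : s * s = s) : s = res m (s.invFun ⊤) := by
  have hf : ∀ x, s.toFun (s.toFun x) = s.toFun x := fun x => by
    rw [← mul_toFun, h]
  have hg : ∀ x, s.invFun (s.invFun x) = s.invFun x := fun x => by
    rw [← mul_invFun, h]
  have h₁ : ∀ x, s.toFun x ⊓ s.invFun ⊤ = x ⊓ s.invFun ⊤ := fun x => by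
    rw [← s.inv_map, hf, s.inv_map]
  have h₂ : ∀ x, s.invFun x ⊓ s.toFun ⊤ = x ⊓ s.toFun ⊤ := fun x => by
    rw [← s.map_inv, hg, s.map_inv]
  have hle : s.toFun ⊤ ≤ s.invFun ⊤ := by
    have := h₂ ⊤
    rw [top_inf_eq] at this
    exact inf_eq_right.1 this
  exact ext_of_map fun x => by
    rw [res_toFun, ← h₁, inf_eq_left.2 ((s.map_le_top x).trans hle)]

theorem mul_comm_of_idem {s t : PartialIso m} (hs : s * s = s) (ht : t * t = t) :
    s * t = t * s := by
  rw [eq_res_of_idem hs, eq_res_of_idem ht, res_mul_res, res_mul_res, inf_comm]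

theorem mul_symm_mul (s : PartialIso m) : s * s.symm * s = s := by
  rw [mul_assoc, symm_mul_self]
  exact ext_of_map s.map_inf_inv_top

theorem eq_symm_of_mul_mul {s t : PartialIso m} (h₁ : s * t * s = s) (h₂ : t * s * t = t) :
    t = s.symm := by
  have hss : s.symm * s * s.symm = s.symm := mul_symm_mul s.symm
  have hst : (s * t) * (s * t) = s * t := by rw [← mul_assoc, h₁]
  have hts : (t * s) * (t * s) = t * s := by rw [← mul_assoc, h₂]
  have ha : (s.symm * s) * (s.symm * s) = s.symm * s := by rw [← mul_assoc, hss]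
  have hb : (s * s.symm) * (s * s.symm) = s * s.symm := by rw [← mul_assoc, mul_symm_mul]
  calc t = t * (s * s.symm * s) * t := by rw [mul_symm_mul, h₂]
    _ = ((t * s) * (s.symm * s)) * t := by simp only [mul_assoc]
    _ = ((s.symm * s) * (t * s)) * t := by rw [mul_comm_of_idem hts ha]
    _ = s.symm * s * (t * s * t) := by simp only [mul_assoc]
    _ = s.symm * (s * t) := by rw [h₂, mul_assoc]
    _ = s.symm * ((s * s.symm) * (s * t)) := by rw [← mul_assoc (s * s.symm), mul_symm_mul]
    _ = s.symm * ((s * t) * (s * s.symm)) := by rw [mul_comm_of_idem hb hst]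
    _ = s.symm * (s * t * s) * s.symm := by simp only [mul_assoc]
    _ = s.symm := by rw [h₁, hss]

/-- The inverse monoid of measure-preserving partial isomorphisms. -/
def invMonData (m : B → E) : InvMonData (PartialIso m) where
  mul s t := s * t
  one := 1
  zero := res m ⊥
  inv := symm

theorem isInverseMonoid (m : B → E) : IsInverseMonoid (invMonData m) where
  mul_assoc := mul_assoc
  one_mul := one_mul
  mul_one := mul_one
  zero_mul s := ext_of_map fun x => by simp [invMonData]
  mul_zero s := ext_of_map fun x => by simp [invMonData, s.map_bot]
  inv_law₁ := mul_symm_mul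
  inv_law₂ s := mul_symm_mul s.symm
  inv_unique _ _ := eq_symm_of_mul_mul

theorem isIdem_iff {s : PartialIso m} : IsIdem (invMonData m) s ↔ ∃ a, s = res m a :=
  ⟨fun h => ⟨_, eq_res_of_idem h⟩, by rintro ⟨a, rfl⟩; exact res_mul_res_self a⟩

theorem isIdem_res (a : B) : IsIdem (invMonData m) (res m a) := res_mul_res_self a

theorem map_eq_of_le {s t : PartialIso m} (h : ∀ x, s.toFun x ≤ t.toFun x) (x : B) :
    s.toFun x = t.toFun (x ⊓ s.invFun ⊤) := by
  set u := x ⊓ s.invFun ⊤ with hu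
  have hxu : s.toFun x = s.toFun u := (s.map_inf_inv_top x).symm
  rw [hxu]
  refine le_antisymm (h u) ?_
  rw [← sdiff_eq_bot_iff]
  set v := t.toFun u \ s.toFun u with hv
  have hvt : t.toFun (t.invFun v) = v := by
    rw [t.map_inv]
    exact inf_eq_left.2 (sdiff_le.trans (t.map_le_top u))
  have hwu : t.invFun v ≤ u :=
    (t.inv_mono sdiff_le).trans (by rw [t.inv_map]; exact inf_le_left)
  have h₁ : s.toFun (t.invFun v) ≤ v := by
    have := h (t.invFun v)
    rwa [hvt] at this
  have h₂ : s.toFun (t.invFun v) = ⊥ :=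
    disjoint_self.1 (disjoint_sdiff_self_right.mono (s.map_mono hwu) h₁)
  have h₃ : t.invFun v = ⊥ := s.map_eq_bot (hwu.trans inf_le_right) h₂
  rw [← hvt, h₃, t.map_bot]

theorem nle_iff {s t : PartialIso m} :
    nle (invMonData m) s t ↔ ∀ x, s.toFun x ≤ t.toFun x := by
  constructor
  · rintro ⟨e, he, rfl⟩ x
    obtain ⟨a, rfl⟩ := isIdem_iff.1 he
    exact t.map_mono inf_le_left
  · exact fun h => ⟨res m (s.invFun ⊤), isIdem_res _, ext_of_map (map_eq_of_le h)⟩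

theorem isJoin_iff {s t j : PartialIso m} :
    IsJoin (invMonData m) s t j ↔ ∀ x, j.toFun x = s.toFun x ⊔ t.toFun x := by
  simp only [IsJoin, nle_iff]
  constructor
  · rintro ⟨hs, ht, hj⟩ x
    refine le_antisymm ?_ (sup_le (hs x) (ht x))
    refine (hj (j * res m (s.invFun ⊤ ⊔ t.invFun ⊤)) (fun y => ?_) (fun y => ?_) x).trans ?_
    · rw [map_eq_of_le hs]
      exact j.map_mono (inf_le_inf_left y le_sup_left)
    · rw [map_eq_of_le ht]
      exact j.map_mono (inf_le_inf_left y le_sup_right)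
    · rw [mul_toFun, res_toFun, inf_sup_left, j.map_sup, ← map_eq_of_le hs,
        ← map_eq_of_le ht]
  · intro h
    refine ⟨fun x => h x ▸ le_sup_left, fun x => h x ▸ le_sup_right, fun c hs ht x => ?_⟩
    rw [h]
    exact sup_le (hs x) (ht x)

theorem isJoin_res {a b c : B} :
    IsJoin (invMonData m) (res m a) (res m b) (res m c) ↔ c = a ⊔ b := by
  rw [isJoin_iff]
  constructor
  · intro h
    simpa using h ⊤
  · rintro rfl x
    exact inf_sup_left x a b

theorem exists_isJoin {P : PartialAlg E} (hm : IsVaughtMeasure P m) {s t : PartialIso m}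
    (h : Compatible (invMonData m) s t) : ∃ j, IsJoin (invMonData m) s t j := by
  obtain ⟨h₁, h₂⟩ := h
  obtain ⟨e, he⟩ := isIdem_iff.1 h₁
  obtain ⟨k, hk⟩ := isIdem_iff.1 h₂
  have hst : ∀ x, s.invFun (t.toFun x) = x ⊓ e := fun x => congrArg (fun r => r.toFun x) he
  have hts : ∀ x, t.invFun (s.toFun x) = x ⊓ e := fun x => congrArg (fun r => r.invFun x) he
  have hst' : ∀ x, s.toFun (t.invFun x) = x ⊓ k := fun x => congrArg (fun r => r.toFun x) hk
  have hts' : ∀ x, t.toFun (s.invFun x) = x ⊓ k := fun x => congrArg (fun r => r.invFun x) hk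
  have hes : e ≤ s.invFun ⊤ := by
    have := s.inv_le_top (t.toFun ⊤)
    rwa [hst, top_inf_eq] at this
  have het : e ≤ t.invFun ⊤ := by
    have := t.inv_le_top (s.toFun ⊤)
    rwa [hts, top_inf_eq] at this
  have hks : k ≤ s.toFun ⊤ := by
    have := s.map_le_top (t.invFun ⊤)
    rwa [hst', top_inf_eq] at this
  have hkt : k ≤ t.toFun ⊤ := by
    have := t.map_le_top (s.invFun ⊤)
    rwa [hts', top_inf_eq] at this
  have inv_map' : ∀ x, s.invFun (s.toFun x ⊔ t.toFun x) ⊔ t.invFun (s.toFun x ⊔ t.toFun x) =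
      x ⊓ (s.invFun ⊤ ⊔ t.invFun ⊤) := by
    intro x
    rw [s.inv_sup, t.inv_sup, s.inv_map, t.inv_map, hst, hts, ← inf_sup_left, ← inf_sup_left,
      ← inf_sup_left, sup_eq_left.2 hes, sup_eq_right.2 het]
  have map_inv' : ∀ x, s.toFun (s.invFun x ⊔ t.invFun x) ⊔ t.toFun (s.invFun x ⊔ t.invFun x) =
      x ⊓ (s.toFun ⊤ ⊔ t.toFun ⊤) := by
    intro x
    rw [s.map_sup, t.map_sup, s.map_inv, t.map_inv, hst', hts', ← inf_sup_left, ← inf_sup_left,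
      ← inf_sup_left, sup_eq_left.2 hks, sup_eq_right.2 hkt]
  refine ⟨⟨fun x => s.toFun x ⊔ t.toFun x, fun x => s.invFun x ⊔ t.invFun x, fun x y => ?_,
    fun x y => ?_, inv_map', map_inv', fun x => ?_⟩, isJoin_iff.2 fun x => rfl⟩
  · rw [s.map_sup, t.map_sup, sup_sup_sup_comm]
  · rw [s.inv_sup, t.inv_sup, sup_sup_sup_comm]
  · set y := x \ s.invFun ⊤ with hy
    have hagree : ∀ p, p ≤ s.invFun ⊤ → p ≤ t.invFun ⊤ → t.toFun p ≤ s.toFun p := by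
      intro p hps hpt
      have hle : s.toFun p ≤ t.toFun p := by
        have := hst' (t.toFun p)
        rw [t.inv_map, inf_eq_left.2 hpt] at this
        exact this ▸ inf_le_left
      have hpe : p ≤ e := by
        have := s.inv_mono hle
        rw [s.inv_map, inf_eq_left.2 hps, hst] at this
        exact this.trans inf_le_right
      have := t.map_inv (s.toFun p)
      rw [hts, inf_eq_left.2 hpe] at this
      exact this ▸ inf_le_left
    have hsup : s.toFun x ⊔ t.toFun x = s.toFun x ⊔ t.toFun y := by
      have h₃ : t.toFun (x ⊓ s.invFun ⊤) ≤ s.toFun x := by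
        rw [← t.map_inf_inv_top]
        exact (hagree _ (inf_le_left.trans inf_le_right) inf_le_right).trans
          (s.map_mono (inf_le_left.trans inf_le_left))
      have h₄ : t.toFun x = t.toFun (x ⊓ s.invFun ⊤) ⊔ t.toFun y := by
        rw [hy, ← t.map_sup, sup_inf_sdiff]
      rw [h₄, ← sup_assoc, sup_eq_left.2 h₃]
    have hdisj : Disjoint (s.toFun x) (t.toFun y) := by
      rw [disjoint_iff]
      refine t.symm.map_eq_bot (inf_le_right.trans (t.map_le_top y)) ?_
      rw [t.symm.map_inf]
      change t.invFun (s.toFun x) ⊓ t.invFun (t.toFun y) = ⊥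
      rw [hts, t.inv_map]
      exact (disjoint_sdiff_self_right.mono (inf_le_right.trans hes) inf_le_left).eq_bot
    refine Option.some.inj (α := E) ?_
    rw [hsup, ← hm.add _ _ hdisj, s.measure_map, t.measure_map, hm.add]
    · congr 2
      rw [hy, inf_sup_left, sdiff_eq]
      refine le_antisymm (sup_le le_sup_left ?_) (sup_le le_sup_left ?_)
      · exact le_sup_of_le_right (inf_le_inf_right _ inf_le_left)
      · rw [← sup_inf_inf_compl (x := x ⊓ t.invFun ⊤) (y := s.invFun ⊤)]
        refine sup_le_sup (inf_le_inf_right _ inf_le_left) ?_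
        rw [inf_right_comm]
    · exact disjoint_sdiff_self_right.mono inf_le_right inf_le_left

/-- Green's relation `D` on idempotents is equality of measures. -/
theorem dRel_res_iff [Countable B] {P : PartialAlg E} (hm : IsVaughtMeasure P m)
    (h : IsEffectAlgebra P) {a b : B} :
    DRel (invMonData m) (res m a) (res m b) ↔ m a = m b := by
  constructor
  · rintro ⟨s, hs, hs'⟩
    rw [← res_injective ((symm_mul_self s).symm.trans hs),
      ← res_injective ((mul_symm_self s).symm.trans hs'), s.measure_map, top_inf_eq]
  · intro hab
    obtain ⟨s, rfl, rfl⟩ := hm.exists_partialIso h hab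
    exact ⟨s, symm_mul_self s, mul_symm_self s⟩

theorem isIdem_of_dRel {s t : PartialIso m} (h : DRel (invMonData m) s t) :
    (∃ a, s = res m a) ∧ ∃ b, t = res m b := by
  obtain ⟨r, rfl, rfl⟩ := h
  exact ⟨⟨_, symm_mul_self r⟩, ⟨_, mul_symm_self r⟩⟩

theorem mul_res_eq_zero_iff {a b : B} :
    (invMonData m).mul (res m a) (res m b) = (invMonData m).zero ↔ Disjoint a b := by
  rw [disjoint_iff]
  change res m a * res m b = res m ⊥ ↔ _
  rw [res_mul_res]
  exact ⟨res_injective, congrArg _⟩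

theorem isComplPair_iff {s t : PartialIso m} :
    IsComplPair (invMonData m) s t ↔ ∃ a, s = res m a ∧ t = res m aᶜ := by
  constructor
  · rintro ⟨hs, ht, h0, hj⟩
    obtain ⟨a, rfl⟩ := isIdem_iff.1 hs
    obtain ⟨b, rfl⟩ := isIdem_iff.1 ht
    have hc : IsCompl a b :=
      ⟨mul_res_eq_zero_iff.1 h0, codisjoint_iff.2 (isJoin_res (c := ⊤) |>.1 hj).symm⟩
    exact ⟨a, rfl, by rw [hc.compl_eq]⟩
  · rintro ⟨a, rfl, rfl⟩
    exact ⟨isIdem_res _, isIdem_res _, mul_res_eq_zero_iff.2 disjoint_compl_right,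
      isJoin_res (c := ⊤) |>.2 sup_compl_eq_top.symm⟩

variable {P : PartialAlg E}

theorem isBooleanInverseMonoid (hm : IsVaughtMeasure P m) :
    IsBooleanInverseMonoid (invMonData m) where
  invMon := isInverseMonoid m
  joins_exist _ _ := exists_isJoin hm
  mul_join_left c s t j h := by
    rw [isJoin_iff] at h ⊢
    intro x
    change c.toFun (j.toFun x) = c.toFun (s.toFun x) ⊔ c.toFun (t.toFun x)
    rw [h, c.map_sup]
  mul_join_right c s t j h := by
    rw [isJoin_iff] at h ⊢
    exact fun x => h (c.toFun x)
  compl_exists e he := by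
    obtain ⟨a, rfl⟩ := isIdem_iff.1 he
    exact ⟨res m aᶜ, isComplPair_iff.2 ⟨a, rfl, rfl⟩⟩

theorem isFoulis [Countable B] (hm : IsVaughtMeasure P m) (h : IsEffectAlgebra P) :
    IsFoulis (invMonData m) := by
  refine ⟨isBooleanInverseMonoid hm, ?_, ?_⟩
  · intro e f he hf hD hle
    obtain ⟨a, rfl⟩ := isIdem_iff.1 he
    obtain ⟨b, rfl⟩ := isIdem_iff.1 hf
    rw [dRel_res_iff hm h] at hD
    have hba : b ≤ a := by simpa using nle_iff.1 hle ⊤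
    rw [hm.eq_of_le h hba hD.symm]
  · intro e f e' f' hD he hf
    obtain ⟨a, rfl, rfl⟩ := isComplPair_iff.1 he
    obtain ⟨b, rfl, rfl⟩ := isComplPair_iff.1 hf
    rw [dRel_res_iff hm h] at hD ⊢
    exact hm.map_compl_eq h hD

theorem jle_iff [Countable B] (hm : IsVaughtMeasure P m) (h : IsEffectAlgebra P)
    {s t : PartialIso m} :
    Jle (invMonData m) s t ↔ P.le (m (s.invFun ⊤)) (m (t.invFun ⊤)) := by
  constructor
  · rintro ⟨a, b, rfl⟩
    change P.le (m (b.invFun (t.invFun (a.invFun ⊤)))) _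
    have := b.symm.measure_map (t.invFun (a.invFun ⊤))
    rw [symm_toFun] at this
    rw [this]
    exact hm.le_of_le (inf_le_left.trans (t.inv_le_top _))
  · intro hle
    obtain ⟨c, hc, hcm⟩ := hm.exists_le_of_le hle
    obtain ⟨r, hr, hr'⟩ := hm.exists_partialIso h hcm.symm
    refine ⟨s * r.symm * t.symm, r, ext_of_map fun x => ?_⟩
    change s.toFun x = s.toFun (r.invFun (t.invFun (t.toFun (r.toFun x))))
    have hrx : r.toFun x ≤ t.invFun ⊤ := (r.map_le_top x).trans (hr' ▸ hc)
    rw [t.inv_map, inf_eq_left.2 hrx, r.inv_map, hr, s.map_inf_inv_top]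

theorem latticeCondition [Countable B] (hm : IsVaughtMeasure P m) (h : IsEffectAlgebra P)
    (hl : LatticeOrdered P) : LatticeCondition (invMonData m) := by
  intro s t
  have hrep : ∀ v, ∃ r : PartialIso m, m (r.invFun ⊤) = v := fun v => by
    obtain ⟨a, rfl⟩ := hm.surjective h v
    exact ⟨res m a, by simp⟩
  simp only [jle_iff hm h]
  obtain ⟨⟨v, hv₁, hv₂, hv₃⟩, w, hw₁, hw₂, hw₃⟩ := hl (m (s.invFun ⊤)) (m (t.invFun ⊤))
  obtain ⟨p, rfl⟩ := hrep v
  obtain ⟨q, rfl⟩ := hrep w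
  exact ⟨⟨p, hv₁, hv₂, fun c => hv₃ _⟩, q, hw₁, hw₂, fun c => hw₃ _⟩

theorem oplusEq_res_iff [Countable B] (hm : IsVaughtMeasure P m) (h : IsEffectAlgebra P)
    {a b c : B} : OplusEq (invMonData m) (res m a) (res m b) (res m c) ↔
      P.add (m a) (m b) = some (m c) := by
  constructor
  · rintro ⟨e, f, j, he, hf, hae, hbf, h0, hj, hjc⟩
    obtain ⟨a', rfl⟩ := isIdem_iff.1 he
    obtain ⟨b', rfl⟩ := isIdem_iff.1 hf
    obtain ⟨c', rfl⟩ := (isIdem_of_dRel hjc).1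
    rw [dRel_res_iff hm h] at hae hbf hjc
    rw [hae, hbf, hm.add _ _ (mul_res_eq_zero_iff.1 h0), ← isJoin_res.1 hj, hjc]
  · intro hc
    obtain ⟨a', b', hd, rfl, ha, hb⟩ := hm.split c _ _ hc
    exact ⟨res m a', res m b', res m (a' ⊔ b'), isIdem_res _, isIdem_res _,
      (dRel_res_iff hm h).2 ha.symm, (dRel_res_iff hm h).2 hb.symm,
      mul_res_eq_zero_iff.2 hd, isJoin_res.2 rfl, (dRel_res_iff hm h).2 rfl⟩

theorem mvCoordinatizes [Countable B] (hm : IsVaughtMeasure P m) (h : IsEffectAlgebra P) :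
    MVCoordinatizes (invMonData m) P := by
  have hφ : ∀ a : B, m ((res m a).invFun ⊤) = m a := fun a => by simp
  refine ⟨fun s => m (s.invFun ⊤), fun e f he hf => ?_, fun v => ?_, ?_, ?_,
    fun e f z he hf => ?_, fun e f hef => ?_⟩
  · obtain ⟨a, rfl⟩ := isIdem_iff.1 he
    obtain ⟨b, rfl⟩ := isIdem_iff.1 hf
    simp only [hφ]
    exact (dRel_res_iff hm h).symm
  · obtain ⟨a, rfl⟩ := hm.surjective h v
    exact ⟨res m a, isIdem_res a, hφ a⟩
  · exact (hφ ⊥).trans (hm.map_bot h)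
  · exact (hφ ⊤).trans hm.top
  · obtain ⟨a, rfl⟩ := isIdem_iff.1 he
    obtain ⟨b, rfl⟩ := isIdem_iff.1 hf
    simp only [hφ]
    constructor
    · intro hz
      obtain ⟨c, rfl⟩ := hm.surjective h z
      exact ⟨res m c, isIdem_res c, (oplusEq_res_iff hm h).2 hz, hφ c⟩
    · rintro ⟨g, hg, hab, rfl⟩
      obtain ⟨c, rfl⟩ := isIdem_iff.1 hg
      rw [hφ]
      exact (oplusEq_res_iff hm h).1 hab
  · obtain ⟨a, rfl, rfl⟩ := isComplPair_iff.1 hef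
    simp only [hφ]
    rw [hm.add _ _ disjoint_compl_right, sup_compl_eq_top, hm.top]

end PartialIso

/-- **Co-ordinatization Theorem.** Every countable MV-algebra can be co-ordinatized by a
Foulis monoid satisfying the lattice condition: there is a completely semisimple Boolean
inverse monoid `S` in which `D` preserves complementation, whose poset of principal ideals
`S/J = E(S)/D` is a lattice, such that `S/J`, with the partial operation `⊕` and
complementation `[e]' = [ē]`, is isomorphic to `E` as an MV-algebra. -/
theorem countable_MV_coordinatization (E : Type) (P : PartialAlg E)
    (hcount : Countable E) (hMV : IsMV P) :
    ∃ (S : Type) (M : InvMonData S),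
      IsFoulis M ∧ LatticeCondition M ∧ MVCoordinatizes M P := by
  obtain ⟨h, hl, hr⟩ := hMV
  obtain ⟨B, _, _, m, hm⟩ := exists_vaughtMeasure h hr
  exact ⟨PartialIso m, PartialIso.invMonData m, PartialIso.isFoulis hm h,
    PartialIso.latticeCondition hm h hl, PartialIso.mvCoordinatizes hm h⟩

end Coordinatization
end

section
/- Every finite MV-algebra can be co-ordinatized by a semisimple inverse monoid: for each finite MV-algebra E there is a finite direct product S of finite symmetric inverse monoids such that S is a Foulis monoid satisfying the lattice condition and S/J is isomorphic to E as an MV-algebra. -/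
namespace Coordinatization

/-- The symmetric inverse monoid `Iₙ` of all partial bijections of `Fin n`,
with composition as multiplication, the identity as `1`, the empty map as `0`,
and the inverse partial bijection as inversion. -/
def symData (n : ℕ) : InvMonData (PEquiv (Fin n) (Fin n)) where
  mul f g := g.trans f
  one := PEquiv.refl (Fin n)
  zero := ⊥
  inv f := f.symm

/-- Direct products of inverse monoids, with componentwise operations. -/
def piData {ι : Type} {β : ι → Type} (Ms : ∀ i, InvMonData (β i)) :
    InvMonData (∀ i, β i) where
  mul f g i := (Ms i).mul (f i) (g i)
  one i := (Ms i).one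
  zero i := (Ms i).zero
  inv f i := (Ms i).inv (f i)

/-- A semisimple inverse monoid: the finite direct product `I_{m 0} × ⋯ × I_{m (k-1)}`
of finite symmetric inverse monoids. -/
def ssData (k : ℕ) (m : Fin k → ℕ) :
    InvMonData (∀ i : Fin k, PEquiv (Fin (m i)) (Fin (m i))) :=
  piData (fun i => symData (m i))

/-- The partial identity `1_A` on a subset `A` of `Fin n`. -/
def pid {n : ℕ} (A : Finset (Fin n)) : PEquiv (Fin n) (Fin n) where
  toFun x := if x ∈ A then some x else none
  invFun x := if x ∈ A then some x else none
  inv a b := by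
    by_cases ha : a ∈ A <;> by_cases hb : b ∈ A <;>
      simp_all [Option.mem_def, eq_comm] <;> aesop

end Coordinatization
namespace Coordinatization

open Finset

/-! ### Partial bijections of a finite set -/

section PartialBijections

variable {n : ℕ}

lemma mem_pid {A : Finset (Fin n)} {x y : Fin n} : y ∈ pid A x ↔ x ∈ A ∧ y = x := by
  show y ∈ (if x ∈ A then some x else none) ↔ _
  split_ifs with h <;> simp [h, eq_comm]

lemma pequiv_ext_mem {f g : PEquiv (Fin n) (Fin n)} (h : ∀ x y, y ∈ f x ↔ y ∈ g x) : f = g :=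
  PEquiv.ext fun x => Option.ext fun y => h x y

/-- The domain of definition of a partial bijection. -/
def dom (f : PEquiv (Fin n) (Fin n)) : Finset (Fin n) := univ.filter fun x => ∃ y, y ∈ f x

lemma mem_dom {f : PEquiv (Fin n) (Fin n)} {x : Fin n} : x ∈ dom f ↔ ∃ y, y ∈ f x := by
  simp [dom]

@[simp] lemma dom_pid (A : Finset (Fin n)) : dom (pid A) = A := by
  ext x
  simp only [mem_dom, mem_pid, exists_and_left, exists_eq, and_true]

@[simp] lemma dom_bot : dom (⊥ : PEquiv (Fin n) (Fin n)) = ∅ := by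
  ext x; simp [mem_dom]

@[simp] lemma dom_refl : dom (PEquiv.refl (Fin n)) = univ := by
  ext x; simp [mem_dom]

lemma dom_mono {f g : PEquiv (Fin n) (Fin n)} (h : f ≤ g) : dom f ⊆ dom g := by
  intro x hx
  obtain ⟨y, hy⟩ := mem_dom.1 hx
  exact mem_dom.2 ⟨y, h x y hy⟩

lemma trans_self_iff {f : PEquiv (Fin n) (Fin n)} :
    f.trans f = f ↔ ∀ x y, y ∈ f x → y = x := by
  constructor
  · intro h x y hy
    have hy' := hy
    rw [← h, PEquiv.mem_trans] at hy'
    obtain ⟨z, hz, hzy⟩ := hy'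
    obtain rfl : z = y := Option.mem_unique hz hy
    exact PEquiv.inj f hzy hy
  · intro h
    refine pequiv_ext_mem fun x y => ?_
    rw [PEquiv.mem_trans]
    constructor
    · rintro ⟨z, hz, hzy⟩
      obtain rfl := h x z hz
      exact hzy
    · intro hy
      obtain rfl := h x y hy
      exact ⟨_, hy, hy⟩

lemma eq_pid_dom {f : PEquiv (Fin n) (Fin n)} (h : f.trans f = f) : f = pid (dom f) := by
  rw [trans_self_iff] at h
  refine pequiv_ext_mem fun x y => ?_
  rw [mem_pid, mem_dom]
  constructor
  · intro hy
    exact ⟨⟨y, hy⟩, h x y hy⟩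
  · rintro ⟨⟨z, hz⟩, rfl⟩
    obtain rfl := h _ z hz
    exact hz

lemma pid_trans_self (A : Finset (Fin n)) : (pid A).trans (pid A) = pid A :=
  trans_self_iff.2 fun _ _ h => (mem_pid.1 h).2

lemma trans_symm_eq_pid (f : PEquiv (Fin n) (Fin n)) : f.trans f.symm = pid (dom f) := by
  refine pequiv_ext_mem fun x y => ?_
  rw [mem_pid, mem_dom, PEquiv.mem_trans]
  constructor
  · rintro ⟨z, hz, hy⟩
    rw [PEquiv.mem_iff_mem] at hy
    exact ⟨⟨z, hz⟩, PEquiv.inj f hy hz⟩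
  · rintro ⟨⟨z, hz⟩, rfl⟩
    exact ⟨z, hz, (PEquiv.mem_iff_mem f).2 hz⟩

lemma pid_dom_trans (f : PEquiv (Fin n) (Fin n)) : (pid (dom f)).trans f = f := by
  refine pequiv_ext_mem fun x y => ?_
  rw [PEquiv.mem_trans]
  constructor
  · rintro ⟨z, hz, hy⟩
    obtain ⟨-, rfl⟩ := mem_pid.1 hz
    exact hy
  · intro hy
    exact ⟨x, mem_pid.2 ⟨mem_dom.2 ⟨y, hy⟩, rfl⟩, hy⟩

lemma trans_symm_trans (f : PEquiv (Fin n) (Fin n)) : f.trans (f.symm.trans f) = f := by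
  rw [← PEquiv.trans_assoc, trans_symm_eq_pid, pid_dom_trans]

lemma eq_symm_of_trans {f g : PEquiv (Fin n) (Fin n)} (h₁ : f.trans (g.trans f) = f)
    (h₂ : g.trans (f.trans g) = g) : g = f.symm := by
  have key : ∀ {p q : PEquiv (Fin n) (Fin n)}, p.trans (q.trans p) = p →
      ∀ x y, x ∈ p y → y ∈ q x := by
    intro p q h x y hx
    have hx' := hx
    rw [← h, PEquiv.mem_trans] at hx'
    obtain ⟨z, hz, hzx⟩ := hx'
    obtain ⟨w, hw, hwx⟩ := (PEquiv.mem_trans q p _ _).1 hzx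
    obtain rfl : z = x := Option.mem_unique hz hx
    obtain rfl : w = y := PEquiv.inj p hwx hx
    exact hw
  refine pequiv_ext_mem fun x y => ?_
  rw [PEquiv.mem_iff_mem]
  exact ⟨key h₂ y x, key h₁ x y⟩

lemma le_iff_exists_idem {f g : PEquiv (Fin n) (Fin n)} :
    f ≤ g ↔ ∃ e : PEquiv (Fin n) (Fin n), e.trans e = e ∧ f = e.trans g := by
  constructor
  · intro h
    refine ⟨pid (dom f), pid_trans_self _, pequiv_ext_mem fun x y => ?_⟩
    rw [PEquiv.mem_trans]
    constructor
    · intro hy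
      exact ⟨x, mem_pid.2 ⟨mem_dom.2 ⟨y, hy⟩, rfl⟩, h x y hy⟩
    · rintro ⟨z, hz, hy⟩
      obtain ⟨hx, rfl⟩ := mem_pid.1 hz
      obtain ⟨w, hw⟩ := mem_dom.1 hx
      obtain rfl : w = y := Option.mem_unique (h _ _ hw) hy
      exact hw
  · rintro ⟨e, he, rfl⟩ x y hy
    obtain ⟨z, hz, hy⟩ := (PEquiv.mem_trans _ _ _ _).1 hy
    exact trans_self_iff.1 he x z hz ▸ hy

lemma isLUB_pair_iff {f g j : PEquiv (Fin n) (Fin n)} :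
    IsLUB {f, g} j ↔ ∀ x y, y ∈ j x ↔ y ∈ f x ∨ y ∈ g x := by
  constructor
  · intro h x y
    have hf : f ≤ j := h.1 (by simp)
    have hg : g ≤ j := h.1 (by simp)
    refine ⟨fun hy => ?_, fun hy => hy.elim (hf x y) (hg x y)⟩
    have hu : j ≤ (pid (dom f ∪ dom g)).trans j := by
      refine h.2 ?_
      rintro p (rfl | rfl) x y hy
      · exact (PEquiv.mem_trans _ _ _ _).2
          ⟨x, mem_pid.2 ⟨mem_union_left _ (mem_dom.2 ⟨y, hy⟩), rfl⟩, hf x y hy⟩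
      · exact (PEquiv.mem_trans _ _ _ _).2
          ⟨x, mem_pid.2 ⟨mem_union_right _ (mem_dom.2 ⟨y, hy⟩), rfl⟩, hg x y hy⟩
    obtain ⟨z, hz, -⟩ := (PEquiv.mem_trans _ _ _ _).1 (hu x y hy)
    obtain ⟨hx, rfl⟩ := mem_pid.1 hz
    rcases mem_union.1 hx with hx | hx <;> obtain ⟨w, hw⟩ := mem_dom.1 hx
    · obtain rfl : w = y := Option.mem_unique (hf _ _ hw) hy
      exact Or.inl hw
    · obtain rfl : w = y := Option.mem_unique (hg _ _ hw) hy
      exact Or.inr hw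
  · intro h
    refine ⟨?_, fun c hc x y hy => ?_⟩
    · rintro p (rfl | rfl) x y hy
      · exact (h x y).2 (Or.inl hy)
      · exact (h x y).2 (Or.inr hy)
    · have hf : f ≤ c := hc (by simp)
      have hg : g ≤ c := hc (by simp)
      exact ((h x y).1 hy).elim (hf x y) (hg x y)

lemma exists_isLUB_pair {f g : PEquiv (Fin n) (Fin n)}
    (h₁ : (g.trans f.symm).trans (g.trans f.symm) = g.trans f.symm)
    (h₂ : (g.symm.trans f).trans (g.symm.trans f) = g.symm.trans f) :
    ∃ j, IsLUB {f, g} j := by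
  rw [trans_self_iff] at h₁ h₂
  have inj : ∀ x x' y, y ∈ f x → y ∈ g x' → x = x' := fun x x' y hf hg =>
    h₁ x' x ((PEquiv.mem_trans _ _ _ _).2 ⟨y, hg, (PEquiv.mem_iff_mem f).2 hf⟩)
  have fn : ∀ x y y', y ∈ f x → y' ∈ g x → y = y' := fun x y y' hf hg =>
    h₂ y' y ((PEquiv.mem_trans _ _ _ _).2 ⟨x, (PEquiv.mem_iff_mem g).2 hg, hf⟩)
  have hor : ∀ (p q : PEquiv (Fin n) (Fin n)), (∀ x y y', y ∈ p x → y' ∈ q x → y = y') →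
      ∀ x y, y ∈ (p x).or (q x) ↔ y ∈ p x ∨ y ∈ q x := by
    intro p q hpq x y
    rcases hp : p x with _ | a
    · simp
    · rcases hq : q x with _ | b
      · simp
      · obtain rfl := hpq x a b hp hq
        simp
  have hor₁ := hor f g fn
  have hor₂ := hor f.symm g.symm fun x y y' hf hg =>
    inj y y' x ((PEquiv.mem_iff_mem f).1 hf) ((PEquiv.mem_iff_mem g).1 hg)
  refine ⟨⟨fun x => (f x).or (g x), fun y => (f.symm y).or (g.symm y), fun x y => ?_⟩,
    isLUB_pair_iff.2 fun x y => hor₁ x y⟩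
  rw [← Option.mem_def, ← Option.mem_def, hor₁, hor₂, PEquiv.mem_iff_mem, PEquiv.mem_iff_mem]

lemma isLUB_trans_left {f g j : PEquiv (Fin n) (Fin n)} (c : PEquiv (Fin n) (Fin n))
    (h : IsLUB {f, g} j) : IsLUB {c.trans f, c.trans g} (c.trans j) := by
  rw [isLUB_pair_iff] at h ⊢
  intro x y
  simp only [PEquiv.mem_trans, h]
  grind

lemma isLUB_trans_right {f g j : PEquiv (Fin n) (Fin n)} (c : PEquiv (Fin n) (Fin n))
    (h : IsLUB {f, g} j) : IsLUB {f.trans c, g.trans c} (j.trans c) := by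
  rw [isLUB_pair_iff] at h ⊢
  intro x y
  simp only [PEquiv.mem_trans, h]
  grind

lemma isLUB_pid_union (A B : Finset (Fin n)) : IsLUB {pid A, pid B} (pid (A ∪ B)) := by
  rw [isLUB_pair_iff]
  intro x y
  simp only [mem_pid, mem_union]
  tauto

lemma pid_trans_pid_eq_bot {A B : Finset (Fin n)} (h : Disjoint A B) :
    (pid B).trans (pid A) = ⊥ := by
  refine pequiv_ext_mem fun x y => ?_
  simp only [PEquiv.mem_trans, mem_pid, PEquiv.bot_apply, Option.not_mem_none, iff_false]
  rintro ⟨z, ⟨hB, rfl⟩, hA, -⟩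
  exact disjoint_left.1 h hA hB

lemma card_dom_symm (f : PEquiv (Fin n) (Fin n)) : #(dom f.symm) = #(dom f) := by
  have key : ∀ g : PEquiv (Fin n) (Fin n), #(dom g) ≤ #(dom g.symm) := by
    intro g
    have hg : ∀ x ∈ dom g, ∃ y, y ∈ g x := fun x hx => mem_dom.1 hx
    choose! F hF using hg
    refine card_le_card_of_injOn F (fun x hx => ?_) fun x hx y hy hxy => ?_
    · exact mem_dom.2 ⟨x, (PEquiv.mem_iff_mem g).2 (hF x hx)⟩
    · exact PEquiv.inj g (hF x hx) (hxy ▸ hF y hy)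
  exact le_antisymm (by simpa using key f.symm) (key f)

lemma dom_trans_subset (f g : PEquiv (Fin n) (Fin n)) : dom (f.trans g) ⊆ dom f := by
  intro x hx
  obtain ⟨y, hy⟩ := mem_dom.1 hx
  obtain ⟨z, hz, -⟩ := (PEquiv.mem_trans _ _ _ _).1 hy
  exact mem_dom.2 ⟨z, hz⟩

lemma card_dom_trans_le_left (f g : PEquiv (Fin n) (Fin n)) : #(dom (f.trans g)) ≤ #(dom f) :=
  card_le_card (dom_trans_subset f g)

lemma card_dom_trans_le_right (f g : PEquiv (Fin n) (Fin n)) : #(dom (f.trans g)) ≤ #(dom g) := by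
  rw [← card_dom_symm, ← card_dom_symm g]
  exact card_dom_trans_le_left g.symm f.symm

lemma exists_dom_eq {A B : Finset (Fin n)} (h : #A = #B) :
    ∃ f : PEquiv (Fin n) (Fin n), dom f = A ∧ dom f.symm = B := by
  let σ : Equiv.Perm (Fin n) := (Finset.equivOfCardEq h).extendSubtype
  have hσ : ∀ x, σ x ∈ B ↔ x ∈ A := fun x =>
    ⟨fun hx => by_contra fun hA => Equiv.extendSubtype_not_mem _ x hA hx,
      fun hx => Equiv.extendSubtype_mem _ x hx⟩
  have hmem : ∀ x y, y ∈ (pid A).trans σ.toPEquiv x ↔ x ∈ A ∧ y = σ x := by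
    intro x y
    simp only [PEquiv.mem_trans, mem_pid, Equiv.toPEquiv_apply, Option.mem_some_iff]
    grind
  refine ⟨(pid A).trans σ.toPEquiv, ?_, ?_⟩
  · ext x
    simp [mem_dom, hmem]
  · ext y
    simp only [mem_dom, PEquiv.mem_iff_mem, hmem]
    constructor
    · rintro ⟨x, hx, rfl⟩
      exact (hσ x).2 hx
    · intro hy
      exact ⟨σ.symm y, (hσ _).1 (by simpa using hy), by simp⟩

lemma exists_trans_eq {f g : PEquiv (Fin n) (Fin n)} (h : #(dom f) ≤ #(dom g)) :
    ∃ a b : PEquiv (Fin n) (Fin n), f = b.trans (g.trans a) := by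
  obtain ⟨B, hB, hcard⟩ := exists_subset_card_eq h
  obtain ⟨b, hb, hb'⟩ := exists_dom_eq hcard.symm
  have hdom : dom (b.trans g) = dom f := by
    refine (dom_trans_subset b g).antisymm (fun x hx => ?_) |>.trans hb
    obtain ⟨y, hy⟩ := mem_dom.1 hx
    have hyB : y ∈ B := by
      rw [← hb']
      exact mem_dom.2 ⟨x, (PEquiv.mem_iff_mem b).2 hy⟩
    obtain ⟨z, hz⟩ := mem_dom.1 (hB hyB)
    exact mem_dom.2 ⟨z, (PEquiv.mem_trans _ _ _ _).2 ⟨y, hy, hz⟩⟩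
  refine ⟨(b.trans g).symm.trans f, b, ?_⟩
  rw [← PEquiv.trans_assoc, ← PEquiv.trans_assoc, trans_symm_eq_pid, hdom, pid_dom_trans]

lemma dom_of_isLUB {f g j : PEquiv (Fin n) (Fin n)} (h : IsLUB {f, g} j) :
    dom j = dom f ∪ dom g := by
  rw [isLUB_pair_iff] at h
  ext x
  simp only [mem_union, mem_dom, h, exists_or]

lemma disjoint_dom {f g : PEquiv (Fin n) (Fin n)} (hf : f.trans f = f) (hg : g.trans g = g)
    (h : g.trans f = ⊥) : Disjoint (dom f) (dom g) := by
  rw [disjoint_left]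
  intro x hxf hxg
  rw [eq_pid_dom hf, eq_pid_dom hg] at h
  have hx : x ∈ (pid (dom g)).trans (pid (dom f)) x :=
    (PEquiv.mem_trans _ _ _ _).2 ⟨x, mem_pid.2 ⟨hxg, rfl⟩, mem_pid.2 ⟨hxf, rfl⟩⟩
  simp [h] at hx

/-- The set of the first `r` elements of `Fin n`. -/
def initSeg (n r : ℕ) : Finset (Fin n) := univ.filter fun x => x.val < r

lemma card_initSeg {r : ℕ} (h : r ≤ n) : #(initSeg n r) = r := by
  rw [initSeg, Fin.card_filter_val_lt, min_eq_right h]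

lemma initSeg_mono {r s : ℕ} (h : r ≤ s) : initSeg n r ⊆ initSeg n s := by
  intro x hx
  simp only [initSeg, mem_filter] at hx ⊢
  exact ⟨hx.1, by omega⟩

end PartialBijections

/-! ### Semisimple inverse monoids -/

section Semisimple

variable {k : ℕ} {m : Fin k → ℕ}

/-- The sizes of the domains of the components. -/
def rk (f : ∀ i : Fin k, PEquiv (Fin (m i)) (Fin (m i))) (i : Fin k) : ℕ := #(dom (f i))

lemma rk_le (f : ∀ i : Fin k, PEquiv (Fin (m i)) (Fin (m i))) : rk f ≤ m := fun i => by
  simpa [rk] using card_le_univ (dom (f i))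

lemma isIdem_iff {e : ∀ i : Fin k, PEquiv (Fin (m i)) (Fin (m i))} :
    IsIdem (ssData k m) e ↔ ∀ i, (e i).trans (e i) = e i := funext_iff

lemma isIdem_pid (A : ∀ i, Finset (Fin (m i))) : IsIdem (ssData k m) fun i => pid (A i) :=
  isIdem_iff.2 fun i => pid_trans_self (A i)

lemma nle_iff {a b : ∀ i : Fin k, PEquiv (Fin (m i)) (Fin (m i))} :
    nle (ssData k m) a b ↔ a ≤ b := by
  constructor
  · rintro ⟨e, he, rfl⟩ i
    exact le_iff_exists_idem.2 ⟨e i, isIdem_iff.1 he i, rfl⟩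
  · intro h
    choose e he hab using fun i => le_iff_exists_idem.1 (h i)
    exact ⟨e, isIdem_iff.2 he, funext hab⟩

lemma isJoin_iff {a b j : ∀ i : Fin k, PEquiv (Fin (m i)) (Fin (m i))} :
    IsJoin (ssData k m) a b j ↔ ∀ i, IsLUB {a i, b i} (j i) := by
  have h : IsJoin (ssData k m) a b j ↔ IsLUB {a, b} j := by
    simp only [IsJoin, nle_iff, IsLUB, IsLeast, mem_upperBounds, mem_lowerBounds,
      Set.mem_insert_iff, Set.mem_singleton_iff, forall_eq_or_imp, forall_eq, and_imp, and_assoc]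
  rw [h, isLUB_pi]
  simp only [Set.image_pair, Function.eval]

lemma isInverseMonoid_ssData : IsInverseMonoid (ssData k m) where
  mul_assoc a b c := funext fun i => (PEquiv.trans_assoc (c i) (b i) (a i)).symm
  one_mul a := funext fun i => PEquiv.trans_refl (a i)
  mul_one a := funext fun i => PEquiv.refl_trans (a i)
  zero_mul a := funext fun i => PEquiv.trans_bot (a i)
  mul_zero a := funext fun i => PEquiv.bot_trans (a i)
  inv_law₁ a := funext fun i => trans_symm_trans (a i)
  inv_law₂ a := funext fun i => trans_symm_trans (a i).symm
  inv_unique _ _ h₁ h₂ := funext fun i => eq_symm_of_trans (congrFun h₁ i) (congrFun h₂ i)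

lemma isComplPair_pid_compl {e : ∀ i : Fin k, PEquiv (Fin (m i)) (Fin (m i))}
    (he : IsIdem (ssData k m) e) :
    IsComplPair (ssData k m) e fun i => pid (dom (e i))ᶜ := by
  have he' := fun i => eq_pid_dom (isIdem_iff.1 he i)
  refine ⟨he, isIdem_pid _, funext fun i => ?_, isJoin_iff.2 fun i => ?_⟩
  · show (pid (dom (e i))ᶜ).trans (e i) = ⊥
    conv_lhs => rw [he' i]
    rw [dom_pid]
    exact pid_trans_pid_eq_bot disjoint_compl_right
  · have h := isLUB_pid_union (dom (e i)) (dom (e i))ᶜ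
    rw [← he' i, union_compl] at h
    convert h using 1
    refine pequiv_ext_mem fun x y => ?_
    show y ∈ some x ↔ _
    rw [mem_pid]
    simp [eq_comm]

lemma isBooleanInverseMonoid_ssData : IsBooleanInverseMonoid (ssData k m) where
  invMon := isInverseMonoid_ssData
  joins_exist _ _ h := by
    choose j hj using fun i =>
      exists_isLUB_pair (isIdem_iff.1 h.1 i) (isIdem_iff.1 h.2 i)
    exact ⟨j, isJoin_iff.2 hj⟩
  mul_join_left c _ _ _ h := isJoin_iff.2 fun i => isLUB_trans_right (c i) (isJoin_iff.1 h i)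
  mul_join_right c _ _ _ h := isJoin_iff.2 fun i => isLUB_trans_left (c i) (isJoin_iff.1 h i)
  compl_exists _ he := ⟨_, isComplPair_pid_compl he⟩

lemma DRel.rk_eq {e f : ∀ i : Fin k, PEquiv (Fin (m i)) (Fin (m i))}
    (h : DRel (ssData k m) e f) : rk e = rk f := by
  obtain ⟨a, rfl, rfl⟩ := h
  funext i
  have h₁ : dom ((a i).trans (a i).symm) = dom (a i) := by rw [trans_symm_eq_pid, dom_pid]
  have h₂ : dom ((a i).symm.trans (a i)) = dom (a i).symm := by
    simpa using congrArg dom (trans_symm_eq_pid (a i).symm)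
  calc #(dom ((a i).trans (a i).symm)) = #(dom (a i)) := by rw [h₁]
    _ = #(dom ((a i).symm.trans (a i))) := by rw [h₂, card_dom_symm]

lemma dRel_iff {e f : ∀ i : Fin k, PEquiv (Fin (m i)) (Fin (m i))}
    (he : IsIdem (ssData k m) e) (hf : IsIdem (ssData k m) f) :
    DRel (ssData k m) e f ↔ rk e = rk f := by
  refine ⟨DRel.rk_eq, fun h => ?_⟩
  choose a ha ha' using fun i => exists_dom_eq (congrFun h i)
  refine ⟨a, funext fun i => ?_, funext fun i => ?_⟩
  · show (a i).trans (a i).symm = e i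
    rw [trans_symm_eq_pid, ha, ← eq_pid_dom (isIdem_iff.1 he i)]
  · show (a i).symm.trans (a i) = f i
    have := trans_symm_eq_pid (a i).symm
    rw [PEquiv.symm_symm, ha', ← eq_pid_dom (isIdem_iff.1 hf i)] at this
    exact this

lemma rk_join {e f j : ∀ i : Fin k, PEquiv (Fin (m i)) (Fin (m i))}
    (he : IsIdem (ssData k m) e) (hf : IsIdem (ssData k m) f)
    (h : (ssData k m).mul e f = (ssData k m).zero) (hj : IsJoin (ssData k m) e f j) :
    rk j = rk e + rk f := by
  funext i
  have hd := disjoint_dom (isIdem_iff.1 he i) (isIdem_iff.1 hf i) (congrFun h i)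
  show #(dom (j i)) = #(dom (e i)) + #(dom (f i))
  rw [dom_of_isLUB (isJoin_iff.1 hj i), card_union_of_disjoint hd]

@[simp] lemma rk_one : rk (ssData k m).one = m := by
  funext i
  show #(dom (PEquiv.refl (Fin (m i)))) = m i
  simp

@[simp] lemma rk_zero : rk (ssData k m).zero = 0 := by
  funext i
  show #(dom (⊥ : PEquiv (Fin (m i)) (Fin (m i)))) = 0
  simp

lemma IsComplPair.rk_add {e f : ∀ i : Fin k, PEquiv (Fin (m i)) (Fin (m i))}
    (h : IsComplPair (ssData k m) e f) : rk e + rk f = m := by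
  rw [← rk_join h.1 h.2.1 h.2.2.1 h.2.2.2, rk_one]

theorem isFoulis_ssData : IsFoulis (ssData k m) := by
  refine ⟨isBooleanInverseMonoid_ssData, fun e f he hf hD hle => funext fun i => ?_,
    fun e f e' f' hD he hf => ?_⟩
  · have hsub := dom_mono (nle_iff.1 hle i)
    have hcard : #(dom (e i)) = #(dom (f i)) := congrFun hD.rk_eq i
    rw [eq_pid_dom (isIdem_iff.1 he i), eq_pid_dom (isIdem_iff.1 hf i),
      eq_of_subset_of_card_le hsub hcard.le]
  · rw [dRel_iff he.2.1 hf.2.1]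
    have h₁ := he.rk_add
    have h₂ := hf.rk_add
    rw [hD.rk_eq] at h₁
    exact add_left_cancel (h₁.trans h₂.symm)

lemma jle_iff {s t : ∀ i : Fin k, PEquiv (Fin (m i)) (Fin (m i))} :
    Jle (ssData k m) s t ↔ rk s ≤ rk t := by
  constructor
  · rintro ⟨a, b, rfl⟩ i
    exact (card_dom_trans_le_right (b i) ((t i).trans (a i))).trans
      (card_dom_trans_le_left (t i) (a i))
  · intro h
    choose a b hab using fun i => exists_trans_eq (h i)
    exact ⟨a, b, funext hab⟩

/-- A representative idempotent of given rank. -/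
def stdIdem (m r : Fin k → ℕ) : ∀ i : Fin k, PEquiv (Fin (m i)) (Fin (m i)) :=
  fun i => pid (initSeg (m i) (r i))

lemma isIdem_stdIdem (r : Fin k → ℕ) : IsIdem (ssData k m) (stdIdem m r) := isIdem_pid _

lemma rk_stdIdem {r : Fin k → ℕ} (h : r ≤ m) : rk (stdIdem m r) = r := by
  funext i
  simp [rk, stdIdem, card_initSeg (h i)]

theorem latticeCondition_ssData : LatticeCondition (ssData k m) := by
  intro s t
  have hinf : rk (stdIdem m (rk s ⊓ rk t)) = rk s ⊓ rk t :=
    rk_stdIdem (inf_le_left.trans (rk_le s))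
  have hsup : rk (stdIdem m (rk s ⊔ rk t)) = rk s ⊔ rk t :=
    rk_stdIdem (sup_le (rk_le s) (rk_le t))
  simp only [jle_iff]
  exact ⟨⟨_, hinf.le.trans inf_le_left, hinf.le.trans inf_le_right,
      fun c hs ht => (le_inf hs ht).trans hinf.ge⟩,
    ⟨_, le_sup_left.trans hsup.ge, le_sup_right.trans hsup.ge,
      fun c hs ht => hsup.le.trans (sup_le hs ht)⟩⟩

lemma oplusEq_iff {e f g : ∀ i : Fin k, PEquiv (Fin (m i)) (Fin (m i))}
    (he : IsIdem (ssData k m) e) (hf : IsIdem (ssData k m) f) (hg : IsIdem (ssData k m) g) :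
    OplusEq (ssData k m) e f g ↔ rk e + rk f = rk g := by
  constructor
  · rintro ⟨e', f', j, he', hf', hDe, hDf, hz, hj, hDg⟩
    rw [← hDg.rk_eq, rk_join he' hf' hz hj, hDe.rk_eq, hDf.rk_eq]
  · intro h
    have hle : rk e + rk f ≤ m := h ▸ rk_le g
    have hsub : ∀ i, initSeg (m i) (rk e i) ⊆ initSeg (m i) ((rk e + rk f) i) :=
      fun i => initSeg_mono (Nat.le_add_right _ _)
    have hf'k : rk (fun i => pid (initSeg (m i) ((rk e + rk f) i) \ initSeg (m i) (rk e i)))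
        = rk f := by
      funext i
      rw [rk, dom_pid, card_sdiff_of_subset (hsub i), card_initSeg (hle i),
        card_initSeg (rk_le e i), Pi.add_apply, Nat.add_sub_cancel_left]
    refine ⟨stdIdem m (rk e),
      fun i => pid (initSeg (m i) ((rk e + rk f) i) \ initSeg (m i) (rk e i)),
      stdIdem m (rk e + rk f), isIdem_stdIdem _, isIdem_pid _, ?_, ?_, funext fun i => ?_,
      isJoin_iff.2 fun i => ?_, ?_⟩
    · rw [dRel_iff he (isIdem_stdIdem _), rk_stdIdem (rk_le e)]
    · rw [dRel_iff hf (isIdem_pid _), hf'k]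
    · exact pid_trans_pid_eq_bot disjoint_sdiff
    · have := isLUB_pid_union (initSeg (m i) (rk e i))
        (initSeg (m i) ((rk e + rk f) i) \ initSeg (m i) (rk e i))
      rwa [union_sdiff_of_subset (hsub i)] at this
    · rw [dRel_iff (isIdem_stdIdem _) hg, rk_stdIdem hle, h]

theorem mvCoordinatizes_of_equiv {E : Type} {P : PartialAlg E} (ρ : E → Fin k → ℕ)
    (hinj : Function.Injective ρ) (hrange : Set.range ρ = Set.Iic m)
    (hzero : ρ P.zero = 0) (hone : ρ P.one = m)
    (hadd : ∀ x y z, P.add x y = some z ↔ ρ x + ρ y = ρ z) :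
    MVCoordinatizes (ssData k m) P := by
  have hle : ∀ x, ρ x ≤ m := fun x => hrange.le ⟨x, rfl⟩
  have hex : ∀ e : ∀ i : Fin k, PEquiv (Fin (m i)) (Fin (m i)), ∃ x, ρ x = rk e :=
    fun e => hrange.ge (rk_le e)
  choose φ hφ using hex
  refine ⟨φ, fun e f he hf => ?_, fun x => ⟨stdIdem m (ρ x), isIdem_stdIdem _, ?_⟩,
    hinj ?_, hinj ?_, fun e f z he hf => ?_, fun e e' h => ?_⟩
  · rw [dRel_iff he hf, ← hφ, ← hφ, hinj.eq_iff]
  · exact hinj (by rw [hφ, rk_stdIdem (hle x)])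
  · rw [hφ, rk_zero, hzero]
  · rw [hφ, rk_one, hone]
  · rw [hadd, hφ, hφ]
    constructor
    · intro h
      have hz := rk_stdIdem (hle z)
      exact ⟨stdIdem m (ρ z), isIdem_stdIdem _,
        (oplusEq_iff he hf (isIdem_stdIdem _)).2 (h.trans hz.symm), hinj (by rw [hφ, hz])⟩
    · rintro ⟨g, hg, h, rfl⟩
      rw [hφ, (oplusEq_iff he hf hg).1 h]
  · rw [hadd, hφ, hφ, h.rk_add, hone]

end Semisimple

/-! ### Finite effect algebras with refinement -/

section EffectAlgebra

variable {E : Type} {P : PartialAlg E}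

lemma IsEffectAlgebra.zero_add (hP : IsEffectAlgebra P) (a : E) : P.add P.zero a = some a := by
  have hone : P.add P.zero P.one = some P.one := by
    obtain ⟨z, hz, -⟩ := hP.compl P.one
    have : z = P.zero := (hP.one_def z).1 (by rw [hP.comm, hz]; rfl)
    rw [hP.comm, ← this, hz]
  obtain ⟨b, hb, -⟩ := hP.compl a
  have h := hP.assoc P.zero a b
  rw [hb, Option.bind_some, hone] at h
  obtain ⟨c, hc, hcb⟩ := Option.bind_eq_some_iff.1 h
  rw [hP.comm] at hb hcb
  rw [hc, (hP.compl b).unique hcb hb]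

/-- The partial operation extended to `Option E`, with `none` as an absorbing element. -/
def PartialAlg.totalAdd (P : PartialAlg E) (x y : Option E) : Option E :=
  x.bind fun a => y.bind fun b => P.add a b

/-- The totalization of an effect algebra is a commutative monoid. -/
@[reducible] def IsEffectAlgebra.addCommMonoid (hP : IsEffectAlgebra P) :
    AddCommMonoid (Option E) :=
  letI : Add (Option E) := ⟨P.totalAdd⟩
  letI : Zero (Option E) := ⟨some P.zero⟩
  have zero_add (x : Option E) : 0 + x = x := by
    rcases x with _ | a
    · rfl
    · exact hP.zero_add a
  have add_comm (x y : Option E) : x + y = y + x := by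
    rcases x with _ | a <;> rcases y with _ | b <;>
      first
      | exact hP.comm a b
      | rfl
  { add_assoc := fun x y z => by
      show P.totalAdd (P.totalAdd x y) z = P.totalAdd x (P.totalAdd y z)
      rcases x with _ | a <;> rcases y with _ | b <;> rcases z with _ | c <;>
        simp [PartialAlg.totalAdd, hP.assoc]
    zero_add := zero_add
    add_zero := fun x => (add_comm x 0).trans (zero_add x)
    add_comm := add_comm
    nsmul := nsmulRec }

/-- An abstract form of the totalization of an effect algebra with refinement: a commutative
monoid with an absorbing element `t`. -/
structure IsTotalized {M : Type} [AddCommMonoid M] (t u : M) : Prop where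
  add_top : ∀ a, a + t = t
  unit_ne : u ≠ t
  cancel : ∀ a b c, a + b = a + c → a + b ≠ t → b = c
  pos : ∀ a b : M, a + b = 0 → a = 0
  compl : ∀ a, a ≠ t → ∃ b, a + b = u
  refine : ∀ a₁ a₂ b₁ b₂ : M, a₁ + a₂ = b₁ + b₂ → a₁ + a₂ ≠ t →
    ∃ c₁₁ c₁₂ c₂₁ c₂₂, c₁₁ + c₁₂ = a₁ ∧ c₂₁ + c₂₂ = a₂ ∧ c₁₁ + c₂₁ = b₁ ∧ c₁₂ + c₂₂ = b₂

/-- The elements that do not decompose nontrivially. -/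
structure Indec {M : Type} [AddCommMonoid M] (t a : M) : Prop where
  ne_zero : a ≠ 0
  ne_top : a ≠ t
  split : ∀ b c, b + c = a → b = 0 ∨ c = 0

namespace IsTotalized

variable {M : Type} [AddCommMonoid M] {t u : M}

lemma ne_top_left (h : IsTotalized t u) {a b : M} (hab : a + b ≠ t) : a ≠ t := by
  rintro rfl
  exact hab (by rw [add_comm, h.add_top])

lemma ne_top_right (h : IsTotalized t u) {a b : M} (hab : a + b ≠ t) : b ≠ t := by
  rintro rfl
  exact hab (h.add_top a)

lemma exists_indec_sum [Finite M] (h : IsTotalized t u) (a : M) (ha : a ≠ t) :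
    ∃ T : Multiset M, (∀ x ∈ T, Indec t x) ∧ T.sum = a := by
  induction hN : {b | ∃ c, b + c = a}.ncard using Nat.strong_induction_on generalizing a with
  | _ N ih =>
    by_cases h0 : a = 0
    · exact ⟨0, by simp, by simp [h0]⟩
    by_cases hi : Indec t a
    · exact ⟨{a}, by simpa using hi, by simp⟩
    have hsplit : ∃ b c, b + c = a ∧ b ≠ 0 ∧ c ≠ 0 := by
      by_contra! hcon
      exact hi ⟨h0, ha, fun b c hbc => or_iff_not_imp_left.2 (hcon b c hbc)⟩
    obtain ⟨b, c, rfl, hb, hc⟩ := hsplit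
    have key : ∀ b c : M, b + c ≠ t → c ≠ 0 →
        {x | ∃ d, x + d = b}.ncard < {x | ∃ d, x + d = b + c}.ncard := by
      intro b c hbc hc
      refine Set.ncard_lt_ncard ⟨?_, fun hsub => ?_⟩ (Set.toFinite _)
      · rintro x ⟨d, rfl⟩
        exact ⟨d + c, by rw [add_assoc]⟩
      · obtain ⟨d, hd⟩ := hsub ⟨0, add_zero (b + c)⟩
        have hbt := h.ne_top_left hbc
        have h0 : b + (c + d) = b + 0 := by rw [← add_assoc, hd, add_zero]
        have := h.cancel _ _ _ h0 (by rwa [h0, add_zero])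
        exact hc (h.pos _ _ this)
    obtain ⟨T₁, hT₁, hs₁⟩ := ih _ (hN ▸ key b c ha hc) b (h.ne_top_left ha) rfl
    obtain ⟨T₂, hT₂, hs₂⟩ := ih _ (hN ▸ add_comm c b ▸ key c b (add_comm b c ▸ ha) hb) c
      (h.ne_top_right ha) rfl
    refine ⟨T₁ + T₂, fun x hx => ?_, by rw [Multiset.sum_add, hs₁, hs₂]⟩
    exact (Multiset.mem_add.1 hx).elim (hT₁ x) (hT₂ x)

lemma mem_of_add_eq_sum (h : IsTotalized t u) {a : M} (ha : Indec t a) (T : Multiset M)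
    (hT : ∀ x ∈ T, Indec t x) (c : M) (hc : a + c = T.sum) (hne : T.sum ≠ t) : a ∈ T := by
  induction T using Multiset.induction_on generalizing c with
  | empty => exact absurd (h.pos _ _ (by simpa using hc)) ha.ne_zero
  | cons b T ih =>
    rw [Multiset.sum_cons] at hc hne
    obtain ⟨c₁₁, c₁₂, c₂₁, c₂₂, h₁, h₂, h₃, h₄⟩ := h.refine _ _ _ _ hc (hc ▸ hne)
    rcases ha.split _ _ h₁ with rfl | rfl
    · rw [zero_add] at h₁
      subst h₁
      exact Multiset.mem_cons_of_mem
        (ih (fun x hx => hT x (Multiset.mem_cons_of_mem hx)) c₂₂ h₄ (h.ne_top_right hne))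
    · rw [add_zero] at h₁
      subst h₁
      rcases (hT b (Multiset.mem_cons_self b T)).split _ _ h₃ with h0 | rfl
      · exact absurd h0 ha.ne_zero
      · rw [add_zero] at h₃
        exact h₃ ▸ Multiset.mem_cons_self _ _

lemma indec_sum_unique (h : IsTotalized t u) (T T' : Multiset M)
    (hT : ∀ x ∈ T, Indec t x) (hT' : ∀ x ∈ T', Indec t x) (hs : T.sum = T'.sum)
    (hne : T.sum ≠ t) : T = T' := by
  induction T using Multiset.induction_on generalizing T' with
  | empty =>
    induction T' using Multiset.induction_on with
    | empty => rfl
    | cons b T' _ =>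
      rw [Multiset.sum_zero, Multiset.sum_cons] at hs
      exact absurd (h.pos _ _ hs.symm) (hT' b (Multiset.mem_cons_self b T')).ne_zero
  | cons a T ih =>
    rw [Multiset.sum_cons] at hs hne
    have hmem := h.mem_of_add_eq_sum (hT a (Multiset.mem_cons_self a T)) T' hT' _ hs (hs ▸ hne)
    obtain ⟨T'', rfl⟩ := Multiset.exists_cons_of_mem hmem
    rw [Multiset.sum_cons] at hs
    rw [ih T'' (fun x hx => hT x (Multiset.mem_cons_of_mem hx))
      (fun x hx => hT' x (Multiset.mem_cons_of_mem hx)) (h.cancel _ _ _ hs hne)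
      (h.ne_top_right hne)]

/-- Coordinates with respect to the indecomposable elements. -/
theorem exists_coordinates [Finite M] (h : IsTotalized t u) :
    ∃ (k : ℕ) (ρ : M → Fin k → ℕ), Set.InjOn ρ {t}ᶜ ∧ ρ '' {t}ᶜ = Set.Iic (ρ u) ∧
      ∀ x y z, x ≠ t → y ≠ t → z ≠ t → (x + y = z ↔ ρ x + ρ y = ρ z) := by
  classical
  obtain ⟨k, ⟨α⟩⟩ := Finite.exists_equiv_fin {a : M // Indec t a}
  have hs := h.exists_indec_sum
  choose! s hsI hsum using hs
  let ρ : M → Fin k → ℕ := fun x i => (s x).count (α.symm i).1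
  have hext : ∀ T T' : Multiset M, (∀ x ∈ T, Indec t x) → (∀ x ∈ T', Indec t x) →
      (∀ i, T.count (α.symm i).1 ≤ T'.count (α.symm i).1) → T ≤ T' := by
    intro T T' hT hT' hle
    rw [Multiset.le_iff_count]
    intro a
    by_cases ha : a ∈ T
    · simpa using hle (α ⟨a, hT a ha⟩)
    · simp [Multiset.count_eq_zero_of_notMem ha]
  have hs_eq : ∀ T : Multiset M, (∀ x ∈ T, Indec t x) → T.sum ≠ t → s T.sum = T :=
    fun T hT hne => h.indec_sum_unique _ _ (hsI _ hne) hT (hsum _ hne) (by rwa [hsum _ hne])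
  have hadd : ∀ x y, x + y ≠ t → s (x + y) = s x + s y := by
    intro x y hne
    have hx := h.ne_top_left hne
    have hy := h.ne_top_right hne
    have hS : (s x + s y).sum = x + y := by rw [Multiset.sum_add, hsum x hx, hsum y hy]
    rw [← hS]
    exact hs_eq _ (fun a ha => (Multiset.mem_add.1 ha).elim (hsI x hx a) (hsI y hy a))
      (hS ▸ hne)
  have hinj : Set.InjOn ρ {t}ᶜ := by
    intro x hx y hy hxy
    rw [← hsum x hx, ← hsum y hy]
    congr 1
    exact le_antisymm (hext _ _ (hsI x hx) (hsI y hy) fun i => (congrFun hxy i).le)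
      (hext _ _ (hsI y hy) (hsI x hx) fun i => (congrFun hxy i).ge)
  have hle_u : ∀ x, x ≠ t → ρ x ≤ ρ u := by
    intro x hx i
    obtain ⟨y, hy⟩ := h.compl x hx
    show (s x).count _ ≤ (s u).count _
    rw [← hy, hadd x y (hy ▸ h.unit_ne), Multiset.count_add]
    exact Nat.le_add_right _ _
  have hsummable : ∀ T : Multiset M, (∀ x ∈ T, Indec t x) →
      (∀ i, T.count (α.symm i).1 ≤ ρ u i) → T.sum ≠ t := by
    intro T hT hle
    obtain ⟨R, hR⟩ := Multiset.le_iff_exists_add.1 (hext T (s u) hT (hsI u h.unit_ne) hle)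
    have hu := hsum u h.unit_ne
    rw [hR, Multiset.sum_add] at hu
    exact h.ne_top_left (hu ▸ h.unit_ne)
  refine ⟨k, ρ, hinj, Set.Subset.antisymm ?_ fun r hr => ?_, fun x y z hx hy hz => ?_⟩
  · rintro _ ⟨x, hx, rfl⟩
    exact hle_u x hx
  · let T : Multiset M := ∑ i, Multiset.replicate (r i) (α.symm i).1
    have hcount : ∀ i, T.count (α.symm i).1 = r i := by
      intro i
      simp only [T, Multiset.count_sum', Multiset.count_replicate]
      rw [Finset.sum_eq_single i]
      · simp
      · intro j _ hj
        rw [if_neg]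
        exact fun heq => hj (α.symm.injective (Subtype.ext heq))
      · simp
    have hT : ∀ x ∈ T, Indec t x := by
      intro x hx
      obtain ⟨i, -, hi⟩ := Multiset.mem_sum.1 hx
      rw [Multiset.eq_of_mem_replicate hi]
      exact (α.symm i).2
    have hne := hsummable T hT fun i => (hcount i).le.trans (hr i)
    refine ⟨T.sum, hne, funext fun i => ?_⟩
    show (s T.sum).count _ = r i
    rw [hs_eq T hT hne, hcount]
  · have hρ : ∀ x y, x + y ≠ t → ρ (x + y) = ρ x + ρ y := by
      intro x y hne
      funext i
      show (s (x + y)).count _ = _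
      rw [hadd x y hne, Multiset.count_add]
      rfl
    constructor
    · rintro rfl
      exact (hρ x y hz).symm
    · intro hxyz
      have hne : x + y ≠ t := by
        have hS : (s x + s y).sum = x + y := by rw [Multiset.sum_add, hsum x hx, hsum y hy]
        rw [← hS]
        refine hsummable _ (fun a ha => (Multiset.mem_add.1 ha).elim (hsI x hx a) (hsI y hy a))
          fun i => ?_
        rw [Multiset.count_add]
        exact (congrFun hxyz i).le.trans (hle_u z hz i)
      exact hinj hne hz ((hρ x y hne).trans hxyz)

end IsTotalized

theorem isTotalized_option (hP : IsEffectAlgebra P) (hR : HasRefinement P) :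
    @IsTotalized (Option E) hP.addCommMonoid none (some P.one) := by
  let := hP.addCommMonoid
  have hsome : ∀ x y : Option E, ∀ v, x + y = some v →
      ∃ a b, x = some a ∧ y = some b ∧ P.add a b = some v := by
    intro x y v h
    obtain ⟨a, ha, h'⟩ := Option.bind_eq_some_iff.1 h
    obtain ⟨b, hb, h''⟩ := Option.bind_eq_some_iff.1 h'
    exact ⟨a, b, ha, hb, h''⟩
  have hcompl : ∀ a : Option E, a ≠ none → ∃ b, a + b = some P.one := by
    intro a ha
    obtain ⟨a, rfl⟩ := Option.ne_none_iff_exists'.1 ha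
    obtain ⟨b, hb, -⟩ := hP.compl a
    exact ⟨some b, hb⟩
  refine ⟨fun a => ?_, Option.some_ne_none _, fun a b c h hne => ?_, fun a b h => ?_, hcompl,
    fun a₁ a₂ b₁ b₂ h hne => ?_⟩
  · rcases a with _ | a <;> rfl
  · obtain ⟨d, hd⟩ := hcompl _ hne
    have key : ∀ b, a + b + d = some P.one →
        ∃ x y, a + d = some x ∧ b = some y ∧ P.add x y = some P.one := by
      intro b hb
      rw [add_right_comm] at hb
      exact hsome _ _ _ hb
    obtain ⟨x, y, hx, rfl, hxy⟩ := key b hd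
    obtain ⟨x', y', hx', rfl, hxy'⟩ := key c (h ▸ hd)
    obtain rfl : x = x' := Option.some_injective _ (hx.symm.trans hx')
    rw [(hP.compl x).unique hxy hxy']
  · have h1 : b + a + some P.one = some P.one := by rw [add_comm b a, h, zero_add]
    rw [add_assoc] at h1
    obtain ⟨_, y, -, hy, -⟩ := hsome _ _ _ h1
    obtain ⟨a, o, rfl, ho, hao⟩ := hsome _ _ _ hy
    obtain rfl := Option.some_injective _ ho
    exact congrArg some ((hP.one_def a).1 (by rw [hao]; rfl))
  · obtain ⟨v, hv⟩ := Option.ne_none_iff_exists'.1 hne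
    obtain ⟨a₁, a₂, rfl, rfl, ha⟩ := hsome _ _ _ hv
    obtain ⟨b₁, b₂, rfl, rfl, hb⟩ := hsome _ _ _ (h ▸ hv)
    obtain ⟨c₁₁, c₁₂, c₂₁, c₂₂, h₁, h₂, h₃, h₄⟩ := hR _ _ _ _ _ ha hb
    exact ⟨some c₁₁, some c₁₂, some c₂₁, some c₂₂, h₁, h₂, h₃, h₄⟩

/-- A finite effect algebra with refinement is a product of finite chains. -/
theorem exists_product_of_chains [Finite E] (hP : IsEffectAlgebra P) (hR : HasRefinement P) :
    ∃ (k : ℕ) (ρ : E → Fin k → ℕ), Function.Injective ρ ∧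
      Set.range ρ = Set.Iic (ρ P.one) ∧ ρ P.zero = 0 ∧
      ∀ x y z, P.add x y = some z ↔ ρ x + ρ y = ρ z := by
  let := hP.addCommMonoid
  obtain ⟨k, ρ, hinj, hrange, hadd⟩ := (isTotalized_option hP hR).exists_coordinates
  have hadd' : ∀ x y z, P.add x y = some z ↔ ρ (some x) + ρ (some y) = ρ (some z) :=
    fun x y z => hadd (some x) (some y) (some z) (by simp) (by simp) (by simp)
  refine ⟨k, fun x => ρ (some x), fun x y hxy => ?_, ?_, ?_, hadd'⟩
  · exact Option.some_injective _ (hinj (by simp) (by simp) hxy)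
  · rw [← hrange, ← Set.compl_range_some, compl_compl, ← Set.range_comp]
    rfl
  · have h0 := (hadd' P.zero P.zero P.zero).1 (hP.zero_add _)
    exact add_eq_left.1 h0

end EffectAlgebra

/-- Every finite MV-algebra can be co-ordinatized by a semisimple inverse monoid:
there is a finite direct product `S = I_{m 0} × ⋯ × I_{m (k-1)}` of finite symmetric
inverse monoids which is a Foulis monoid satisfying the lattice condition, with `S/J`
isomorphic to `E` as an MV-algebra. -/
theorem finite_MV_coordinatization (E : Type) (P : PartialAlg E)
    (hfin : Finite E) (hMV : IsMV P) :
    ∃ (k : ℕ) (m : Fin k → ℕ),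
      IsFoulis (ssData k m) ∧ LatticeCondition (ssData k m) ∧
        MVCoordinatizes (ssData k m) P := by
  obtain ⟨hP, -, hR⟩ := hMV
  obtain ⟨k, ρ, hinj, hrange, hzero, hadd⟩ := exists_product_of_chains hP hR
  exact ⟨k, ρ P.one, isFoulis_ssData, latticeCondition_ssData,
    mvCoordinatizes_of_equiv ρ hinj hrange hzero rfl hadd⟩

end Coordinatization
end
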